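/- Suppose w is a null-homotopic word over Q containing exactly two letters from {s, s⁻¹}. Then FFFL(w) ≤ C·ℓ(w), where C > 0 is a constant depending only on Q: the length-one sequence (w) can be converted to a sequence of empty words by free reductions, free expansions, applications of relators of Q, cyclic conjugations and fragmentations, with the total length of every intermediate sequence at most C·ℓ(w). -/

import Mathlib

/-! Words over an alphabet `A`: a letter `(x, true)` is the generator `x`,
and `(x, false)` is its formal inverse `x⁻¹`. -/

/-- A word over the alphabet `A ∪ A⁻¹`. -/
abbrev Word (A : Type*) := List (A × Bool)

namespace Word

/-- The formal inverse of a word. -/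
def inv {A : Type*} (w : Word A) : Word A := (w.map fun p => (p.1, !p.2)).reverse

/-- `w'` is a cyclic conjugate (cyclic permutation) of `w`. -/
def IsCyclicConj {A : Type*} (w w' : Word A) : Prop :=
  ∃ u v : Word A, w = u ++ v ∧ w' = v ++ u

end Word

/-- Moves (i)–(iii) on words with respect to a set `R` of relator words:
free reduction, free expansion, and application of a relator (replace a subword `u`
by `v` where some cyclic conjugate of `u * v⁻¹` lies in `R ∪ R⁻¹`). -/
inductive Move {A : Type*} (R : Set (Word A)) : Word A → Word A → Prop
  | freeReduce (u v : Word A) (x : A) (b : Bool) :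
      Move R (u ++ (x, b) :: (x, !b) :: v) (u ++ v)
  | freeExpand (u v : Word A) (x : A) (b : Bool) :
      Move R (u ++ v) (u ++ (x, b) :: (x, !b) :: v)
  | relator (p q u v z : Word A)
      (hz : Word.IsCyclicConj (u ++ Word.inv v) z) (hR : z ∈ R ∨ Word.inv z ∈ R) :
      Move R (p ++ u ++ q) (p ++ v ++ q)

/-- Moves (i)–(iv): moves (i)–(iii) together with cyclic conjugation. -/
inductive MoveC {A : Type*} (R : Set (Word A)) : Word A → Word A → Prop
  | of {w w' : Word A} : Move R w w' → MoveC R w w'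
  | cyc {w w' : Word A} : Word.IsCyclicConj w w' → MoveC R w w'

/-- Moves (i)–(v) on finite sequences of words: one of the moves (i)–(iv) applied to
one word of the sequence, or fragmentation of one word `u ++ v` into `u` and `v`. -/
inductive MoveF {A : Type*} (R : Set (Word A)) : List (Word A) → List (Word A) → Prop
  | of (l₁ l₂ : List (Word A)) {w w' : Word A} :
      MoveC R w w' → MoveF R (l₁ ++ w :: l₂) (l₁ ++ w' :: l₂)
  | frag (l₁ l₂ : List (Word A)) (u v : Word A) :
      MoveF R (l₁ ++ (u ++ v) :: l₂) (l₁ ++ u :: v :: l₂)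

/-- A word is null-homotopic over the presentation with relator set `R` if it represents
the identity of the presented group, i.e. lies in the normal closure of the relators. -/
def NullHomotopic {A : Type*} (R : Set (Word A)) (w : Word A) : Prop :=
  FreeGroup.mk w ∈ Subgroup.normalClosure (FreeGroup.mk '' R)

/-- `FLle R w L`: the word `w` can be converted to the empty word by moves (i)–(iii)
with every intermediate word of length at most `L`. -/
def FLle {A : Type*} (R : Set (Word A)) (w : Word A) (L : ℕ) : Prop :=
  ∃ (m : ℕ) (f : ℕ → Word A), f 0 = w ∧ f m = [] ∧
    (∀ i < m, Move R (f i) (f (i + 1))) ∧ ∀ i ≤ m, (f i).length ≤ L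

/-- `FFLle R w L`: the word `w` can be converted to the empty word by moves (i)–(iv)
with every intermediate word of length at most `L`. -/
def FFLle {A : Type*} (R : Set (Word A)) (w : Word A) (L : ℕ) : Prop :=
  ∃ (m : ℕ) (f : ℕ → Word A), f 0 = w ∧ f m = [] ∧
    (∀ i < m, MoveC R (f i) (f (i + 1))) ∧ ∀ i ≤ m, (f i).length ≤ L

/-- The total length of a finite sequence of words. -/
def totalLength {A : Type*} (l : List (Word A)) : ℕ := (l.map List.length).sum

/-- `FFFLle R w L`: the length-one sequence `(w)` can be converted to a sequence of empty
words by moves (i)–(v) with every intermediate sequence of total length at most `L`. -/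
def FFFLle {A : Type*} (R : Set (Word A)) (w : Word A) (L : ℕ) : Prop :=
  ∃ (m : ℕ) (f : ℕ → List (Word A)), f 0 = [w] ∧ (∀ u ∈ f m, u = ([] : Word A)) ∧
    (∀ i < m, MoveF R (f i) (f (i + 1))) ∧ ∀ i ≤ m, totalLength (f i) ≤ L

/-- An element `x` of the free group is a conjugate of a relator of `R` or of an inverse
of a relator. -/
def IsConjRelator {A : Type*} (R : Set (Word A)) (x : FreeGroup A) : Prop :=
  ∃ c ρ : FreeGroup A, (ρ ∈ FreeGroup.mk '' R ∨ ρ⁻¹ ∈ FreeGroup.mk '' R) ∧ x = c * ρ * c⁻¹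

/-- `AreaLe R g N`: in the free group, `g` is a product of at most `N` conjugates
of elements of `R ∪ R⁻¹`. -/
def AreaLe {A : Type*} (R : Set (Word A)) (g : FreeGroup A) (N : ℕ) : Prop :=
  ∃ l : List (FreeGroup A), l.length ≤ N ∧ (∀ x ∈ l, IsConjRelator R x) ∧ l.prod = g

/-- The number of occurrences in `w` of the letter `x` or its inverse. -/
def countLtr {A : Type*} [DecidableEq A] (x : A) (w : Word A) : ℕ :=
  (w.filter fun p => p.1 = x).length

/-- The filling length `FL(w)` of a null-homotopic word. -/
noncomputable def FLw {A : Type*} (R : Set (Word A)) (w : Word A) : ℕ :=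
  sInf {L | FLle R w L}

/-- The free filling length `FFL(w)` of a null-homotopic word. -/
noncomputable def FFLw {A : Type*} (R : Set (Word A)) (w : Word A) : ℕ :=
  sInf {L | FFLle R w L}

/-- The fragmenting free filling length `FFFL(w)` of a null-homotopic word. -/
noncomputable def FFFLw {A : Type*} (R : Set (Word A)) (w : Word A) : ℕ :=
  sInf {L | FFFLle R w L}

/-- The filling length function `FL : ℕ → ℕ` of the presentation with relators `R`. -/
noncomputable def FLfn {A : Type*} (R : Set (Word A)) (n : ℕ) : ℕ :=
  sSup (FLw R '' {w | NullHomotopic R w ∧ w.length ≤ n})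

/-- The free filling length function `FFL : ℕ → ℕ`. -/
noncomputable def FFLfn {A : Type*} (R : Set (Word A)) (n : ℕ) : ℕ :=
  sSup (FFLw R '' {w | NullHomotopic R w ∧ w.length ≤ n})

/-- The fragmenting free filling length function `FFFL : ℕ → ℕ`. -/
noncomputable def FFFLfn {A : Type*} (R : Set (Word A)) (n : ℕ) : ℕ :=
  sSup (FFFLw R '' {w | NullHomotopic R w ∧ w.length ≤ n})

/-! The presentation `Q = ⟨a, b, r, s, t | a^b a⁻², [t,a], [r,at], [r,s], [s,t]⟩`. -/

/-- The five generators of the presentation `Q`. -/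
inductive QGen | a | b | r | s | t
deriving DecidableEq

/-- The five relators of `Q`: `b⁻¹aba⁻¹a⁻¹`, `t⁻¹a⁻¹ta`, `r⁻¹t⁻¹a⁻¹rat`,
`r⁻¹s⁻¹rs`, `s⁻¹t⁻¹st`. -/
def QRels : Set (Word QGen) :=
  { [(QGen.b, false), (QGen.a, true), (QGen.b, true), (QGen.a, false), (QGen.a, false)],
    [(QGen.t, false), (QGen.a, false), (QGen.t, true), (QGen.a, true)],
    [(QGen.r, false), (QGen.t, false), (QGen.a, false), (QGen.r, true), (QGen.a, true),
      (QGen.t, true)],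
    [(QGen.r, false), (QGen.s, false), (QGen.r, true), (QGen.s, true)],
    [(QGen.s, false), (QGen.t, false), (QGen.s, true), (QGen.t, true)] }

/-- The word `bⁿ`. -/
def bpow (n : ℕ) : Word QGen := List.replicate n (QGen.b, true)

/-- The word `b⁻ⁿ`. -/
def bpowInv (n : ℕ) : Word QGen := List.replicate n (QGen.b, false)

/-- The word `a^{-bⁿ} = b⁻ⁿ a⁻¹ bⁿ`. -/
def aConjNeg (n : ℕ) : Word QGen := bpowInv n ++ [(QGen.a, false)] ++ bpow n

/-- The word `a^{bⁿ} = b⁻ⁿ a bⁿ`. -/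
def aConjPos (n : ℕ) : Word QGen := bpowInv n ++ [(QGen.a, true)] ++ bpow n

/-- The word `a^{-bⁿ} r a^{bⁿ}`. -/
def gword (n : ℕ) : Word QGen := aConjNeg n ++ [(QGen.r, true)] ++ aConjPos n

/-- The word `w_n = [s, a^{-bⁿ} r a^{bⁿ}] = s⁻¹ (b⁻ⁿa⁻¹bⁿ r b⁻ⁿabⁿ)⁻¹ s (b⁻ⁿa⁻¹bⁿ r b⁻ⁿabⁿ)`. -/
def wn (n : ℕ) : Word QGen :=
  [(QGen.s, false)] ++ Word.inv (gword n) ++ [(QGen.s, true)] ++ gword n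

/-- The word `a^{-bⁿ} r a^{bⁿ} r a^{bⁿ} r⁻¹ a^{-bⁿ}`. -/
def g'word (n : ℕ) : Word QGen :=
  aConjNeg n ++ [(QGen.r, true)] ++ aConjPos n ++ [(QGen.r, true)] ++ aConjPos n ++
    [(QGen.r, false)] ++ aConjNeg n

/-- The word `w'_n = [s, a^{-bⁿ} r a^{bⁿ} r a^{bⁿ} r⁻¹ a^{-bⁿ}]`. -/
def w'n (n : ℕ) : Word QGen :=
  [(QGen.s, false)] ++ Word.inv (g'word n) ++ [(QGen.s, true)] ++ g'word n

section Value

variable {X G H : Type*} [Group G] [Group H]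

/-- The value of a letter under an assignment of group elements to generators. -/
def letterVal (g : X → G) (p : X × Bool) : G := cond p.2 (g p.1) (g p.1)⁻¹

/-- The value of a word under an assignment of group elements to generators. -/
def val (g : X → G) (w : Word X) : G := (w.map (letterVal g)).prod

@[simp] theorem val_nil (g : X → G) : val g [] = 1 := rfl

@[simp] theorem val_cons (g : X → G) (p : X × Bool) (w : Word X) :
    val g (p :: w) = letterVal g p * val g w := by
  simp [val]

@[simp] theorem val_append (g : X → G) (u v : Word X) :
    val g (u ++ v) = val g u * val g v := by
  simp [val]

@[simp] theorem letterVal_true (g : X → G) (x : X) : letterVal g (x, true) = g x := rfl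

@[simp] theorem letterVal_false (g : X → G) (x : X) : letterVal g (x, false) = (g x)⁻¹ := rfl

@[simp] theorem letterVal_not (g : X → G) (x : X) (b : Bool) :
    letterVal g (x, !b) = (letterVal g (x, b))⁻¹ := by
  cases b <;> simp

theorem val_eq_lift (g : X → G) (w : Word X) : val g w = FreeGroup.lift g (FreeGroup.mk w) := by
  rw [FreeGroup.lift_mk]; rfl

theorem map_letterVal (f : G →* H) (g : X → G) (p : X × Bool) :
    f (letterVal g p) = letterVal (fun x => f (g x)) p := by
  obtain ⟨x, b⟩ := p
  cases b <;> simp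

theorem map_val (f : G →* H) (g : X → G) (w : Word X) :
    f (val g w) = val (fun x => f (g x)) w := by
  induction w with
  | nil => simp
  | cons p w ih => simp [ih, map_letterVal]

namespace Word

@[simp] theorem inv_nil : inv ([] : Word X) = [] := rfl

@[simp] theorem inv_cons (p : X × Bool) (w : Word X) : inv (p :: w) = inv w ++ [(p.1, !p.2)] := by
  simp [inv]

@[simp] theorem inv_append (u v : Word X) : inv (u ++ v) = inv v ++ inv u := by
  simp [inv]

@[simp] theorem inv_inv (w : Word X) : inv (inv w) = w := by
  induction w with
  | nil => rfl
  | cons p w ih => simp [ih]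

@[simp] theorem length_inv (w : Word X) : (inv w).length = w.length := by
  simp [inv]

/-- The letter `x` and its inverse do not occur in `w`. -/
def Avoids (x : X) (w : Word X) : Prop := ∀ p ∈ w, p.1 ≠ x

@[simp] theorem avoids_nil (x : X) : Avoids x [] := by simp [Avoids]

@[simp] theorem avoids_cons (x : X) (p : X × Bool) (w : Word X) :
    Avoids x (p :: w) ↔ p.1 ≠ x ∧ Avoids x w := by
  simp [Avoids]

@[simp] theorem avoids_append (x : X) (u v : Word X) :
    Avoids x (u ++ v) ↔ Avoids x u ∧ Avoids x v := by
  simp only [Avoids, List.mem_append, or_imp, forall_and]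

@[simp] theorem avoids_inv (x : X) (w : Word X) : Avoids x (inv w) ↔ Avoids x w := by
  induction w with
  | nil => simp
  | cons p w ih => simp [ih, and_comm]

@[simp] theorem avoids_replicate_self (x : X) (b : Bool) (n : ℕ) {y : X} (h : y ≠ x) :
    Avoids x (List.replicate n (y, b)) := by
  intro p hp
  rw [List.eq_of_mem_replicate hp]
  exact h

end Word

open Word

@[simp] theorem val_inv (g : X → G) (w : Word X) : val g (Word.inv w) = (val g w)⁻¹ := by
  induction w with
  | nil => simp
  | cons p w ih => obtain ⟨x, b⟩ := p; simp [ih]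

theorem val_eq_one_of_nullHomotopic {R : Set (Word X)} (g : X → G)
    (hg : ∀ z ∈ R, val g z = 1) {w : Word X} (hw : NullHomotopic R w) : val g w = 1 := by
  have h : Subgroup.normalClosure (FreeGroup.mk '' R) ≤ (FreeGroup.lift g).ker := by
    apply Subgroup.normalClosure_le_normal
    rintro _ ⟨z, hz, rfl⟩
    simpa [MonoidHom.mem_ker, val_eq_lift] using hg z hz
  rw [val_eq_lift]
  exact h hw

/-- `w` has a subword `x^e κ x^{-e}` where `κ` avoids `x` and takes a value in `A`. -/
def HasPinch (g : X → G) (A : Subgroup G) (x : X) (w : Word X) : Prop :=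
  ∃ (p : Word X) (e : Bool) (κ q : Word X), w = p ++ (x, e) :: κ ++ (x, !e) :: q ∧
    Avoids x κ ∧ val g κ ∈ A

theorem HasPinch.cons {g : X → G} {A : Subgroup G} {x : X} {w : Word X}
    (h : HasPinch g A x w) (y : X × Bool) :
    HasPinch g A x (y :: w) := by
  obtain ⟨p, e, κ, q, rfl, hκ⟩ := h
  exact ⟨y :: p, e, κ, q, by simp, hκ⟩

variable [DecidableEq X]

/-- Adjoin to `G` a stable letter commuting with `A`. -/
abbrev CentralHNN (G : Type*) [Group G] (A : Subgroup G) : Type _ :=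
  HNNExtension G A A (MulEquiv.refl A)

/-- Extend an assignment by sending `x` to the stable letter. -/
def stableAssign (g : X → G) (A : Subgroup G) (x : X) : X → CentralHNN G A :=
  fun y => if y = x then HNNExtension.t else HNNExtension.of (g y)

variable (g : X → G) (A : Subgroup G) (x : X)

theorem letterVal_stableAssign_of_ne {p : X × Bool} (h : p.1 ≠ x) :
    letterVal (stableAssign g A x) p = HNNExtension.of (letterVal g p) := by
  obtain ⟨y, b⟩ := p
  cases b <;> simp_all [stableAssign]

theorem val_stableAssign_of_avoids {w : Word X} (h : Avoids x w) :
    val (stableAssign g A x) w = HNNExtension.of (val g w) := by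
  induction w with
  | nil => simp
  | cons p w ih =>
    simp only [avoids_cons] at h
    simp [ih h.2, letterVal_stableAssign_of_ne g A x h.1]

/-- The exponent of a letter, as a unit. -/
def signUnit (e : Bool) : ℤˣ := cond e 1 (-1)

theorem letterVal_stableAssign_self (e : Bool) :
    letterVal (stableAssign g A x) (x, e) = HNNExtension.t ^ (signUnit e : ℤ) := by
  cases e <;> simp [stableAssign, signUnit]

theorem commute_stableAssign (e : Bool) {a : G} (ha : a ∈ A) :
    Commute (letterVal (stableAssign g A x) (x, e)) (HNNExtension.of a) := by
  have h : Commute (HNNExtension.t : CentralHNN G A) (HNNExtension.of a) :=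
    HNNExtension.t_mul_of (φ := MulEquiv.refl A) ⟨a, ha⟩
  cases e
  · simpa [stableAssign] using h.inv_left
  · simpa [stableAssign] using h

variable {g A x}

/-- A word without pinches defines a reduced word of the HNN extension. -/
theorem hasPinch_or_exists_reducedWord (w : Word X) : HasPinch g A x w ∨
    ∃ ρ : HNNExtension.NormalWord.ReducedWord G A A,
      ρ.prod (MulEquiv.refl A) = val (stableAssign g A x) w ∧
      ((ρ.toList = [] ∧ Avoids x w) ∨ ∃ (κ : Word X) (e : Bool) (q : Word X),
        w = κ ++ (x, e) :: q ∧ Avoids x κ ∧ ρ.head = val g κ ∧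
        ρ.toList.head?.map Prod.fst = some (signUnit e)) := by
  induction w with
  | nil =>
    refine .inr ⟨HNNExtension.NormalWord.ReducedWord.empty G A A, ?_, .inl ⟨rfl, by simp⟩⟩
    simp [HNNExtension.NormalWord.ReducedWord.prod]
  | cons y w ih =>
    obtain h | ⟨ρ, hprod, hρ⟩ := ih
    · exact .inl (h.cons y)
    by_cases hy : y.1 = x
    · obtain ⟨y, e⟩ := y
      obtain rfl : y = x := hy
      have key : HasPinch g A y ((y, e) :: w) ∨ ((signUnit e, ρ.head) :: ρ.toList).IsChain
          (fun a b => a.2 ∈ HNNExtension.toSubgroup A A a.1 → a.1 = b.1) := by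
        obtain hρ | ⟨κ, e', q, rfl, hκ, hhead, hfst⟩ := hρ
        · exact .inr (by simp [hρ.1])
        · by_cases hpin : val g κ ∈ A ∧ e' = !e
          · exact .inl ⟨[], e, κ, q, by simp [hpin.2], hκ, hpin.1⟩
          · right
            cases hl : ρ.toList with
            | nil => simp
            | cons c l =>
              have hc : c.1 = signUnit e' := by simpa [hl] using hfst
              refine List.isChain_cons_cons.2 ⟨fun hA => ?_, hl ▸ ρ.chain⟩
              have hA' : val g κ ∈ A := by
                rw [← hhead]
                cases e <;> simpa [signUnit] using hA
              have : e' = e := by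
                by_contra hne
                exact hpin ⟨hA', by cases e <;> cases e' <;> simp_all⟩
              rw [hc, this]
      obtain h | hchain := key
      · exact .inl h
      refine .inr ⟨⟨1, (signUnit e, ρ.head) :: ρ.toList, hchain⟩, ?_, .inr
        ⟨[], e, w, by simp, by simp, by simp, by simp⟩⟩
      rw [val_cons, ← hprod, letterVal_stableAssign_self]
      simp [HNNExtension.NormalWord.ReducedWord.prod, mul_assoc]
    · refine .inr ⟨⟨letterVal g y * ρ.head, ρ.toList, ρ.chain⟩, ?_, ?_⟩
      · rw [val_cons, ← hprod, letterVal_stableAssign_of_ne g A x hy]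
        simp [HNNExtension.NormalWord.ReducedWord.prod, mul_assoc]
      · obtain hρ | ⟨κ, e', q, rfl, hκ, hhead, hfst⟩ := hρ
        · exact .inl ⟨hρ.1, by simp [hy, hρ.2]⟩
        · exact .inr ⟨y :: κ, e', q, by simp, by simp [hy, hκ], by simp [hhead], hfst⟩

/-- Britton's lemma, for words. -/
theorem hasPinch_of_val_eq_one {w : Word X} (hw : val (stableAssign g A x) w = 1)
    (hx : ¬ Avoids x w) : HasPinch g A x w := by
  obtain h | ⟨ρ, hprod, hρ⟩ := hasPinch_or_exists_reducedWord (g := g) (A := A) (x := x) w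
  · exact h
  have hnil : ρ.toList = [] := by
    apply HNNExtension.ReducedWord.toList_eq_nil_of_mem_of_range (MulEquiv.refl A)
    rw [hprod, hw]
    exact one_mem _
  obtain hρ | ⟨κ, e', q, rfl, hκ, hhead, hfst⟩ := hρ
  · exact absurd hρ.2 hx
  · simp [hnil] at hfst

end Value

open Word

namespace QGroup

/-- Affine bijections of `ℚ` realising `⟨a, b | a^b = a²⟩`; other generators act trivially. -/
def assignBS : QGen → Equiv.Perm ℚ
  | .a => Equiv.addRight 1
  | .b => Equiv.mulRight₀ (2⁻¹ : ℚ) (by norm_num)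
  | _ => 1

/-- The subgroup centralised by `t`. -/
def centT : Subgroup (Equiv.Perm ℚ) := Subgroup.zpowers (assignBS .a)

/-- The group `⟨a, b, t | a^b = a², [t, a]⟩`. -/
abbrev GroupT : Type := CentralHNN (Equiv.Perm ℚ) centT

/-- The generators of `GroupT`. -/
def assignT : QGen → GroupT := stableAssign assignBS centT .t

/-- The subgroup centralised by `r`. -/
def centR : Subgroup GroupT := Subgroup.zpowers (assignT .a * assignT .t)

/-- The group `⟨a, b, r, t | a^b = a², [t, a], [r, at]⟩`. -/
abbrev GroupR : Type := CentralHNN GroupT centR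

/-- The generators of `GroupR`. -/
def assignR : QGen → GroupR := stableAssign assignT centR .r

/-- The subgroup centralised by `s`. -/
def centS : Subgroup GroupR := Subgroup.closure {assignR .r, assignR .t}

/-- The group presented by `Q`. -/
abbrev GroupS : Type := CentralHNN GroupR centS

/-- The generators of `GroupS`. -/
def assignS : QGen → GroupS := stableAssign assignR centS .s

theorem assignBS_conj : assignBS .a * assignBS .b = assignBS .b * (assignBS .a * assignBS .a) := by
  ext x
  simp [assignBS]
  ring

@[simp] theorem assignT_t : assignT .t = HNNExtension.t := rfl
theorem assignT_a : assignT .a = HNNExtension.of (assignBS .a) := rfl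
theorem assignT_b : assignT .b = HNNExtension.of (assignBS .b) := rfl
theorem assignR_a : assignR .a = HNNExtension.of (assignT .a) := rfl
theorem assignR_b : assignR .b = HNNExtension.of (assignT .b) := rfl
theorem assignR_t : assignR .t = HNNExtension.of (assignT .t) := rfl
theorem assignS_a : assignS .a = HNNExtension.of (assignR .a) := rfl
theorem assignS_b : assignS .b = HNNExtension.of (assignR .b) := rfl
theorem assignS_t : assignS .t = HNNExtension.of (assignR .t) := rfl
theorem assignS_r : assignS .r = HNNExtension.of (assignR .r) := rfl

theorem commute_assignT : Commute (assignT .t) (assignT .a) :=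
  commute_stableAssign assignBS _ .t true (Subgroup.mem_zpowers _)

theorem commute_assignR_t_a : Commute (assignR .t) (assignR .a) :=
  commute_assignT.map HNNExtension.of

theorem commute_assignR : Commute (assignR .r) (assignR .a * assignR .t) := by
  rw [assignR_a, assignR_t, ← map_mul]
  exact commute_stableAssign assignT _ .r true (Subgroup.mem_zpowers _)

/-- The images of the generators in a group where the relators of `Q` hold. -/
structure IsModel {G : Type*} [Group G] (g : QGen → G) : Prop where
  conj : g .a * g .b = g .b * (g .a * g .a)
  commute_t_a : Commute (g .t) (g .a)
  commute_r : Commute (g .r) (g .a * g .t)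
  commute_s_r : Commute (g .s) (g .r)
  commute_s_t : Commute (g .s) (g .t)

theorem isModel_assignBS : IsModel assignBS where
  conj := assignBS_conj
  commute_t_a := Commute.one_left _
  commute_r := Commute.one_left _
  commute_s_r := Commute.one_left _
  commute_s_t := Commute.one_left _

theorem isModel_assignT : IsModel assignT where
  conj := by
    rw [assignT_a, assignT_b, ← map_mul, ← map_mul, ← map_mul, assignBS_conj]
  commute_t_a := commute_assignT
  commute_r := by
    rw [show assignT .r = 1 from map_one HNNExtension.of]
    exact Commute.one_left _
  commute_s_r := by
    rw [show assignT .s = 1 from map_one HNNExtension.of]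
    exact Commute.one_left _
  commute_s_t := by
    rw [show assignT .s = 1 from map_one HNNExtension.of]
    exact Commute.one_left _

theorem assignR_s : assignR .s = 1 :=
  (congrArg HNNExtension.of (map_one HNNExtension.of)).trans (map_one HNNExtension.of)

theorem isModel_assignR : IsModel assignR where
  conj := by
    rw [assignR_a, assignR_b, ← map_mul, ← map_mul, ← map_mul, isModel_assignT.conj]
  commute_t_a := commute_assignR_t_a
  commute_r := commute_assignR
  commute_s_r := by rw [assignR_s]; exact Commute.one_left _
  commute_s_t := by rw [assignR_s]; exact Commute.one_left _

theorem isModel_assignS : IsModel assignS where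
  conj := by
    rw [assignS_a, assignS_b, ← map_mul, ← map_mul, ← map_mul, isModel_assignR.conj]
  commute_t_a := commute_assignR_t_a.map (HNNExtension.of : GroupR →* GroupS)
  commute_r := by
    rw [assignS_a, assignS_r, assignS_t, ← map_mul]
    exact commute_assignR.map HNNExtension.of
  commute_s_r := commute_stableAssign assignR _ .s true (Subgroup.subset_closure (.inl rfl))
  commute_s_t := commute_stableAssign assignR _ .s true (Subgroup.subset_closure (.inr rfl))

theorem IsModel.val_relator {G : Type*} [Group G] {g : QGen → G} (hg : IsModel g)
    {z : Word QGen} (hz : z ∈ QRels) : val g z = 1 := by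
  simp only [QRels, Set.mem_insert_iff, Set.mem_singleton_iff] at hz
  have hb := hg.conj
  have ht := hg.commute_t_a.eq
  have hr := hg.commute_r.eq
  have h1 := hg.commute_s_r.eq
  have h2 := hg.commute_s_t.eq
  rcases hz with rfl | rfl | rfl | rfl | rfl <;>
    simp only [val_cons, val_nil, letterVal_true, letterVal_false, mul_one]
  · rw [inv_mul_eq_one.2] <;> simp [← mul_assoc, hb]
  · rw [← mul_assoc, ← mul_inv_rev, ht, inv_mul_eq_one.2 rfl]
  · rw [← mul_assoc (g .t)⁻¹, ← mul_inv_rev, ← mul_assoc, ← mul_inv_rev, hr,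
      inv_mul_eq_one.2 rfl]
  · rw [← mul_assoc, ← mul_inv_rev, h1, inv_mul_eq_one.2 rfl]
  · rw [← mul_assoc, ← mul_inv_rev, ← h2, inv_mul_eq_one.2 rfl]

theorem abs_val_assignBS_lt (w : Word QGen) : |val assignBS w 0| + 1 ≤ 2 ^ w.length := by
  induction w with
  | nil => simp
  | cons p w ih =>
    have key : ∀ y : ℚ, |letterVal assignBS p y| + 1 ≤ 2 * (|y| + 1) := by
      intro y
      obtain ⟨x, b⟩ := p
      have h0 := abs_nonneg y
      have h1 : |y + 1| ≤ |y| + 1 := by simpa using abs_add_le y 1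
      have h2 : |y - 1| ≤ |y| + 1 := by simpa using abs_sub y 1
      cases x <;> cases b <;>
        simp [assignBS, Equiv.Perm.inv_def, abs_mul, ← sub_eq_add_neg] <;> linarith
    rw [val_cons, Equiv.Perm.mul_apply, List.length_cons, pow_succ]
    linarith [key (val assignBS w 0)]

theorem assignBS_a_zpow (k : ℤ) (y : ℚ) : (assignBS .a ^ k) y = y + k := by
  simp [assignBS]

theorem abs_lt_of_val_assignBS {w : Word QGen} {k : ℤ} (h : val assignBS w = assignBS .a ^ k) :
    |k| < 2 ^ w.length := by
  have := abs_val_assignBS_lt w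
  rw [h, assignBS_a_zpow, zero_add] at this
  have h2 : |k| + 1 ≤ 2 ^ w.length := by exact_mod_cast this
  omega

/-- The homomorphism killing `t`. -/
def killT : GroupT →* Equiv.Perm ℚ := HNNExtension.lift (MonoidHom.id _) 1 (by simp)

/-- The exponent sum of `t`. -/
def expT : GroupT →* Multiplicative ℤ := HNNExtension.lift 1 (Multiplicative.ofAdd 1) (by simp)

theorem killT_assignT (x : QGen) : killT (assignT x) = assignBS x := by
  by_cases hx : x = .t
  · subst hx
    exact HNNExtension.lift_t _ _ _
  · rw [assignT, stableAssign, if_neg hx]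
    exact HNNExtension.lift_of _ _ _ _

theorem abs_expT_le (w : Word QGen) : |(expT (val assignT w)).toAdd| ≤ w.length := by
  induction w with
  | nil => simp
  | cons p w ih =>
    have key : |(expT (letterVal assignT p)).toAdd| ≤ 1 := by
      obtain ⟨x, b⟩ := p
      cases x <;> cases b <;> simp [assignT, stableAssign, expT]
    rw [val_cons, map_mul, toAdd_mul, List.length_cons]
    push_cast
    exact (abs_add_le _ _).trans (by linarith)

theorem bounds_of_val_assignT {w : Word QGen} {k m : ℤ}
    (h : val assignT w = assignT .a ^ k * assignT .t ^ m) :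
    |k| < 2 ^ w.length ∧ |m| ≤ w.length := by
  constructor
  · apply abs_lt_of_val_assignBS
    have := congrArg killT h
    rw [map_val, map_mul, map_zpow, map_zpow] at this
    simp only [killT_assignT] at this
    rwa [show assignBS .t = 1 from rfl, one_zpow, mul_one] at this
  · have := abs_expT_le w
    rw [h] at this
    simpa [expT, assignT_a] using this

end QGroup

section Conversion

/-- `u` can be converted to `v` by moves (i)–(iii) through words of length at most `L`. -/
def Conv (L : ℕ) : Word QGen → Word QGen → Prop :=
  Relation.ReflTransGen fun u v => Move QRels u v ∧ u.length ≤ L ∧ v.length ≤ L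

theorem Move.symm {A : Type*} {R : Set (Word A)} {u v : Word A} (h : Move R u v) : Move R v u := by
  cases h with
  | freeReduce p q x b => exact .freeExpand p q x b
  | freeExpand p q x b => exact .freeReduce p q x b
  | relator p q u v z hz hR =>
    obtain ⟨c, d, hcd, rfl⟩ := hz
    refine .relator p q v u (Word.inv c ++ Word.inv d) ⟨Word.inv d, Word.inv c, ?_, rfl⟩ ?_
    · rw [← Word.inv_append, ← hcd]
      simp
    · simpa [or_comm] using hR

theorem Move.ctx {A : Type*} {R : Set (Word A)} {u v : Word A} (h : Move R u v) (p q : Word A) :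
    Move R (p ++ u ++ q) (p ++ v ++ q) := by
  cases h with
  | freeReduce p' q' x b => simpa using Move.freeReduce (R := R) (p ++ p') (q' ++ q) x b
  | freeExpand p' q' x b => simpa using Move.freeExpand (R := R) (p ++ p') (q' ++ q) x b
  | relator p' q' u v z hz hR =>
    simpa using Move.relator (p ++ p') (q' ++ q) u v z hz hR

theorem Move.val_eq {A : Type*} {R : Set (Word A)} {G : Type*} [Group G] {g : A → G}
    (hg : ∀ z ∈ R, val g z = 1) {u v : Word A} (h : Move R u v) : val g u = val g v := by
  cases h with
  | freeReduce p q x b => cases b <;> simp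
  | freeExpand p q x b => cases b <;> simp
  | relator p q u v z hz hR =>
    obtain ⟨c, d, hcd, rfl⟩ := hz
    have h₁ : val g (d ++ c) = 1 := by
      obtain h | h := hR
      · exact hg _ h
      · have := hg _ h
        rwa [val_inv, inv_eq_one] at this
    have h₂ : val g (u ++ Word.inv v) = 1 := by
      rw [val_append, mul_eq_one_comm] at h₁
      rwa [hcd, val_append]
    rw [val_append, val_inv, mul_inv_eq_one] at h₂
    simp [h₂]

theorem Word.isCyclicConj_iff_isRotated {A : Type*} {u v : Word A} :
    Word.IsCyclicConj u v ↔ u ~r v := by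
  constructor
  · rintro ⟨c, d, rfl, rfl⟩
    exact List.isRotated_append
  · rintro h
    obtain ⟨n, hn, rfl⟩ := List.isRotated_iff_mod.1 h
    exact ⟨u.take n, u.drop n, (List.take_append_drop _ _).symm,
      List.rotate_eq_drop_append_take hn⟩

theorem Move.inv {A : Type*} {R : Set (Word A)} {u v : Word A} (h : Move R u v) :
    Move R (Word.inv u) (Word.inv v) := by
  cases h with
  | freeReduce p q x b =>
    simpa using Move.freeReduce (R := R) (Word.inv q) (Word.inv p) x b
  | freeExpand p q x b =>
    simpa using Move.freeExpand (R := R) (Word.inv q) (Word.inv p) x b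
  | relator p q u v z hz hR =>
    have hz' : Word.inv u ++ Word.inv (Word.inv v) ~r Word.inv z := by
      obtain ⟨c, d, hcd, rfl⟩ := hz
      have h₁ : Word.inv u ++ v ~r v ++ Word.inv u := List.isRotated_append
      have h₂ : v ++ Word.inv u = Word.inv d ++ Word.inv c := by
        rw [← Word.inv_append, ← hcd]
        simp
      rw [h₂] at h₁
      simpa using h₁.trans List.isRotated_append
    simpa using Move.relator (Word.inv q) (Word.inv p) _ _ _
      (Word.isCyclicConj_iff_isRotated.2 hz') (by simpa [or_comm] using hR)

namespace Conv

variable {L M : ℕ} {u v w : Word QGen}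

@[refl] theorem refl (L : ℕ) (u : Word QGen) : Conv L u u := Relation.ReflTransGen.refl

theorem of_eq (L : ℕ) (h : u = v) : Conv L u v := h ▸ refl L u

theorem of_move (h : Move QRels u v) (hu : u.length ≤ L) (hv : v.length ≤ L) : Conv L u v :=
  Relation.ReflTransGen.single ⟨h, hu, hv⟩

theorem trans (h₁ : Conv L u v) (h₂ : Conv L v w) : Conv L u w :=
  Relation.ReflTransGen.trans h₁ h₂

theorem symm (h : Conv L u v) : Conv L v u := by
  induction h with
  | refl => exact refl L _
  | tail _ h ih => exact (of_move h.1.symm h.2.2 h.2.1).trans ih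

theorem ctx (h : Conv M u v) (p q : Word QGen) {x y : Word QGen} (hx : x = p ++ u ++ q)
    (hy : y = p ++ v ++ q) (hL : p.length + M + q.length ≤ L) : Conv L x y := by
  subst hx hy
  induction h with
  | refl => exact refl L _
  | tail _ h ih =>
    have := h.2.1
    have := h.2.2
    exact ih.trans (of_move (h.1.ctx p q) (by simp; omega) (by simp; omega))

theorem mono (h : Conv M u v) (hL : M ≤ L) : Conv L u v :=
  h.ctx [] [] (by simp) (by simp) (by simpa)

theorem cancel (p q : Word QGen) (x : QGen) (b : Bool) (hL : p.length + q.length + 2 ≤ L) :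
    Conv L (p ++ (x, b) :: (x, !b) :: q) (p ++ q) :=
  of_move (.freeReduce p q x b) (by simp; omega) (by simp; omega)

theorem cancel' (p q : Word QGen) (x : QGen) (b : Bool) (hL : p.length + q.length + 2 ≤ L) :
    Conv L (p ++ (x, !b) :: (x, b) :: q) (p ++ q) := by
  simpa using cancel p q x (!b) hL

theorem inv_mul_cancel (u : Word QGen) (hL : 2 * u.length ≤ L) :
    Conv L (Word.inv u ++ u) [] := by
  induction u with
  | nil => exact refl L _
  | cons p u ih =>
    simp only [List.length_cons] at hL
    refine Conv.trans ?_ (ih (by omega))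
    simpa using cancel' (Word.inv u) u p.1 p.2 (by simp; omega)

theorem mul_inv_cancel (u : Word QGen) (hL : 2 * u.length ≤ L) :
    Conv L (u ++ Word.inv u) [] := by
  simpa using inv_mul_cancel (Word.inv u) (by simpa)

theorem of_relator (k : ℕ) (z : Word QGen)
    (hz : (u ++ Word.inv v).rotate k = z) (hR : z ∈ QRels ∨ Word.inv z ∈ QRels)
    (hk : k ≤ (u ++ Word.inv v).length)
    (hu : u.length ≤ L) (hv : v.length ≤ L) : Conv L u v := by
  refine of_move ?_ hu hv
  have := Move.relator [] [] u v z ⟨(u ++ Word.inv v).take k, (u ++ Word.inv v).drop k,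
    (List.take_append_drop _ _).symm, by rw [← hz, List.rotate_eq_drop_append_take hk]⟩ hR
  simpa using this

/-- Words are interconvertible as soon as `u v⁻¹` can be filled. -/
theorem of_mul_inv (h : Conv M (u ++ Word.inv v) []) (hM : M + v.length ≤ L)
    (hL : u.length + 2 * v.length ≤ L) : Conv L u v := by
  have h₁ : Conv L u (u ++ Word.inv v ++ v) :=
    ((inv_mul_cancel v le_rfl).ctx u [] (by simp) (by simp) (by simp; omega)).symm
  exact h₁.trans (h.ctx [] v (by simp) (by simp) (by simp; omega))

theorem inv (h : Conv L u v) : Conv L (Word.inv u) (Word.inv v) := by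
  induction h with
  | refl => exact refl L _
  | tail _ h ih => exact ih.trans (of_move h.1.inv (by simpa using h.2.1) (by simpa using h.2.2))

theorem val_eq {G : Type*} [Group G] {g : QGen → G} (hg : QGroup.IsModel g) (h : Conv L u v) :
    val g u = val g v := by
  induction h with
  | refl => rfl
  | tail _ h ih => exact ih.trans (h.1.val_eq fun z hz => hg.val_relator hz)

instance : Trans (Conv L) (Conv L) (Conv L) := ⟨trans⟩

end Conv

end Conversion

/-- The word `at` or its inverse. -/
def atWord (c : Bool) : Word QGen :=
  cond c [(.a, true), (.t, true)] [(.t, false), (.a, false)]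

@[simp] theorem length_atWord (c : Bool) : (atWord c).length = 2 := by cases c <;> rfl

namespace Conv

theorem swap_t_a (b c : Bool) : Conv 2 [(.t, b), (.a, c)] [(.a, c), (.t, b)] := by
  cases b <;> cases c
  all_goals first
    | (refine of_relator 0 _ rfl ?_ (by simp) (by simp) (by simp); simp [QRels]; done)
    | (refine of_relator 1 _ rfl ?_ (by simp) (by simp) (by simp); simp [QRels]; done)
    | (refine of_relator 2 _ rfl ?_ (by simp) (by simp) (by simp); simp [QRels]; done)
    | (refine of_relator 3 _ rfl ?_ (by simp) (by simp) (by simp); simp [QRels]; done)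

theorem swap_s_r (b c : Bool) : Conv 2 [(.s, b), (.r, c)] [(.r, c), (.s, b)] := by
  cases b <;> cases c
  all_goals first
    | (refine of_relator 0 _ rfl ?_ (by simp) (by simp) (by simp); simp [QRels]; done)
    | (refine of_relator 1 _ rfl ?_ (by simp) (by simp) (by simp); simp [QRels]; done)
    | (refine of_relator 2 _ rfl ?_ (by simp) (by simp) (by simp); simp [QRels]; done)
    | (refine of_relator 3 _ rfl ?_ (by simp) (by simp) (by simp); simp [QRels]; done)

theorem swap_s_t (b c : Bool) : Conv 2 [(.s, b), (.t, c)] [(.t, c), (.s, b)] := by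
  cases b <;> cases c
  all_goals first
    | (refine of_relator 0 _ rfl ?_ (by simp) (by simp) (by simp); simp [QRels]; done)
    | (refine of_relator 1 _ rfl ?_ (by simp) (by simp) (by simp); simp [QRels]; done)
    | (refine of_relator 2 _ rfl ?_ (by simp) (by simp) (by simp); simp [QRels]; done)
    | (refine of_relator 3 _ rfl ?_ (by simp) (by simp) (by simp); simp [QRels]; done)

theorem swap_r_at (b c : Bool) : Conv 3 ((.r, b) :: atWord c) (atWord c ++ [(.r, b)]) := by
  cases b <;> cases c
  all_goals first
    | (refine of_relator 0 _ rfl ?_ (by simp) (by simp) (by simp); simp [QRels, atWord]; done)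
    | (refine of_relator 1 _ rfl ?_ (by simp) (by simp) (by simp); simp [QRels, atWord]; done)
    | (refine of_relator 2 _ rfl ?_ (by simp) (by simp) (by simp); simp [QRels, atWord]; done)
    | (refine of_relator 3 _ rfl ?_ (by simp) (by simp) (by simp); simp [QRels, atWord]; done)
    | (refine of_relator 4 _ rfl ?_ (by simp) (by simp) (by simp); simp [QRels, atWord]; done)

theorem double_a (c : Bool) : Conv 3 [(.b, false), (.a, c), (.b, true)] [(.a, c), (.a, c)] := by
  cases c
  all_goals first
    | (refine of_relator 0 _ rfl ?_ (by simp) (by simp) (by simp); simp [QRels]; done)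
    | (refine of_relator 1 _ rfl ?_ (by simp) (by simp) (by simp); simp [QRels]; done)
    | (refine of_relator 2 _ rfl ?_ (by simp) (by simp) (by simp); simp [QRels]; done)
    | (refine of_relator 3 _ rfl ?_ (by simp) (by simp) (by simp); simp [QRels]; done)

theorem double_a' (c : Bool) :
    Conv 4 [(.a, c), (.a, c), (.b, false)] [(.b, false), (.a, c)] := by
  refine ((double_a c).symm.ctx [] [(.b, false)] rfl rfl (by simp)).trans ?_
  exact cancel [(.b, false), (.a, c)] [] .b true (by simp)

/-- `a^c r^b a^{-c}` equals `t^{-c} r^b t^c`. -/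
theorem conj_a_r (b c : Bool) :
    Conv 8 [(.a, c), (.r, b), (.a, !c)] [(.t, !c), (.r, b), (.t, c)] := by
  have h₁ : Conv 8 [(.a, c), (.r, b), (.a, !c)]
      [(.t, !c), (.t, c), (.a, c), (.r, b), (.a, !c)] :=
    (cancel' [] _ .t c (by simp)).symm
  have key : Conv 4 [(.t, c), (.a, c), (.r, b)] [(.r, b), (.a, c), (.t, c)] := by
    cases c
    · exact (((swap_r_at b false).symm.ctx [] [] rfl rfl (by simp)).trans
        ((swap_t_a false false).ctx [(.r, b)] [] rfl rfl (by simp)))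
    · exact (((swap_t_a true true).ctx [] [(.r, b)] rfl rfl (by simp)).trans
        ((swap_r_at b true).symm.ctx [] [] rfl rfl (by simp)))
  have h₂ : Conv 8 [(.t, !c), (.t, c), (.a, c), (.r, b), (.a, !c)]
      [(.t, !c), (.r, b), (.a, c), (.t, c), (.a, !c)] :=
    key.ctx [(.t, !c)] [(.a, !c)] rfl rfl (by simp)
  have h₃ : Conv 8 [(.t, !c), (.r, b), (.a, c), (.t, c), (.a, !c)]
      [(.t, !c), (.r, b), (.a, c), (.a, !c), (.t, c)] :=
    (swap_t_a c (!c)).ctx [(.t, !c), (.r, b), (.a, c)] [] rfl rfl (by simp)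
  have h₄ : Conv 8 [(.t, !c), (.r, b), (.a, c), (.a, !c), (.t, c)] [(.t, !c), (.r, b), (.t, c)] :=
    cancel [(.t, !c), (.r, b)] [(.t, c)] .a c (by simp)
  exact ((h₁.trans h₂).trans h₃).trans h₄

end Conv

section CompressedPowers

/-- A word of logarithmic length representing `a ^ m`. -/
def aPow (m : ℤ) : Word QGen :=
  if m = 0 then [] else if m = -1 then [(.a, false)] else
    (if m % 2 = 1 then [(.a, true)] else []) ++ (.b, false) :: aPow (m / 2) ++ [(.b, true)]
termination_by m.natAbs
decreasing_by omega

@[simp] theorem aPow_zero : aPow 0 = [] := by rw [aPow]; simp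

@[simp] theorem aPow_neg_one : aPow (-1) = [(.a, false)] := by rw [aPow]; simp

theorem aPow_even {q : ℤ} (hq : q ≠ 0) :
    aPow (2 * q) = (.b, false) :: aPow q ++ [(.b, true)] := by
  rw [aPow, if_neg (by omega), if_neg (by omega), if_neg (by omega)]
  simp

theorem aPow_odd {q : ℤ} (hq : q ≠ -1) :
    aPow (2 * q + 1) = (.a, true) :: (.b, false) :: aPow q ++ [(.b, true)] := by
  rw [aPow, if_neg (by omega), if_neg (by omega), if_pos (by omega)]
  have : (2 * q + 1) / 2 = q := by omega
  simp [this]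

theorem aPow_induction {P : ℕ → ℤ → Prop} (zero : ∀ n, P n 0) (neg_one : ∀ n, P n (-1))
    (even : ∀ n q, q ≠ 0 → -2 ^ n ≤ q → q < 2 ^ n → P n q → P (n + 1) (2 * q))
    (odd : ∀ n q, q ≠ -1 → -2 ^ n ≤ q → q < 2 ^ n → P n q → P (n + 1) (2 * q + 1))
    (n : ℕ) (m : ℤ) (h₁ : -2 ^ n ≤ m) (h₂ : m < 2 ^ n) : P n m := by
  induction n generalizing m with
  | zero =>
    obtain rfl | rfl : m = 0 ∨ m = -1 := by simp at h₁ h₂; omega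
    exacts [zero 0, neg_one 0]
  | succ n ih =>
    rw [pow_succ] at h₁ h₂
    by_cases h0 : m = 0
    · exact h0 ▸ zero _
    by_cases h1 : m = -1
    · exact h1 ▸ neg_one _
    have hq := ih (m / 2) (by omega) (by omega)
    obtain h | h := Int.emod_two_eq_zero_or_one m
    · have := even n (m / 2) (by omega) (by omega) (by omega) hq
      rwa [show 2 * (m / 2) = m by omega] at this
    · have := odd n (m / 2) (by omega) (by omega) (by omega) hq
      rwa [show 2 * (m / 2) + 1 = m by omega] at this

theorem length_aPow_le {n : ℕ} {m : ℤ} (h₁ : -2 ^ n ≤ m) (h₂ : m < 2 ^ n) :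
    (aPow m).length ≤ 3 * n + 1 := by
  refine aPow_induction (P := fun n m => (aPow m).length ≤ 3 * n + 1) (by simp) (by simp)
    ?_ ?_ n m h₁ h₂
  · intro n q hq _ _ ih
    rw [aPow_even hq]
    simp
    omega
  · intro n q hq _ _ ih
    rw [aPow_odd hq]
    simp
    omega

theorem natAbs_lt_two_pow {n : ℕ} {m : ℤ} (h : m.natAbs < 2 ^ n) : -2 ^ n < m ∧ m < 2 ^ n := by
  zify at h
  exact abs_lt.1 h

theorem length_aPow_le_of_natAbs {n : ℕ} {m : ℤ} (h : m.natAbs < 2 ^ n) :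
    (aPow m).length ≤ 3 * n + 1 :=
  length_aPow_le (natAbs_lt_two_pow h).1.le (natAbs_lt_two_pow h).2

theorem avoids_aPow {x : QGen} (ha : x ≠ .a) (hb : x ≠ .b) (m : ℤ) : Avoids x (aPow m) := by
  refine aPow_induction (P := fun _ m => Avoids x (aPow m)) ?_ ?_ ?_ ?_ m.natAbs m ?_ ?_
  · simp
  · simp [Ne.symm ha]
  · intro n q hq _ _ ih
    rw [aPow_even hq]
    simp [ih, hb.symm]
  · intro n q hq _ _ ih
    rw [aPow_odd hq]
    simp [ih, ha.symm, hb.symm]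
  all_goals
    have := natAbs_lt_two_pow (Nat.lt_two_pow_self (n := m.natAbs))
    omega

/-- The integer `1` or `-1`. -/
def sg (c : Bool) : ℤ := cond c 1 (-1)

@[simp] theorem sg_true : sg true = 1 := rfl
@[simp] theorem sg_false : sg false = -1 := rfl
@[simp] theorem sg_not (c : Bool) : sg (!c) = -sg c := by cases c <;> rfl
@[simp] theorem natAbs_sg (c : Bool) : (sg c).natAbs = 1 := by cases c <;> rfl

theorem val_aPow {G : Type*} [Group G] (g : QGen → G) (hg : (g .b)⁻¹ * g .a * g .b = g .a * g .a)
    (m : ℤ) : val g (aPow m) = g .a ^ m := by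
  have key : ∀ q : ℤ, (g .b)⁻¹ * g .a ^ q * g .b = g .a ^ (2 * q) := by
    intro q
    have := conj_zpow (i := q) (a := (g .b)⁻¹) (b := g .a)
    rw [_root_.inv_inv, hg] at this
    rw [← this, zpow_mul]
    norm_cast
    rw [pow_two]
  refine aPow_induction (P := fun _ m => val g (aPow m) = g .a ^ m) ?_ ?_ ?_ ?_ m.natAbs m ?_ ?_
  · simp
  · simp
  · intro n q hq _ _ ih
    rw [aPow_even hq]
    simp [ih, ← key, mul_assoc]
  · intro n q hq _ _ ih
    rw [aPow_odd hq, add_comm, zpow_add, ← key]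
    simp [ih, mul_assoc]
  all_goals
    have := natAbs_lt_two_pow (Nat.lt_two_pow_self (n := m.natAbs))
    omega

namespace Conv

theorem cons_aPow_succ {n : ℕ} {m : ℤ} (h₁ : -2 ^ n ≤ m) (h₂ : m < 2 ^ n) :
    Conv (3 * n + 8) ((.a, true) :: aPow m) (aPow (m + 1)) := by
  refine aPow_induction (P := fun n m => Conv (3 * n + 8) ((.a, true) :: aPow m) (aPow (m + 1)))
    ?_ ?_ ?_ ?_ n m h₁ h₂
  · intro n
    rw [show (0 : ℤ) + 1 = 2 * 0 + 1 by simp, aPow_odd (by simp), aPow_zero]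
    exact (cancel' [(.a, true)] [] .b true (by simp)).symm
  · intro n
    simpa using cancel [] [] .a true (L := 3 * n + 8) (by simp)
  · intro n q hq h₁ h₂ ih
    by_cases hq' : q = -1
    · subst hq'
      rw [aPow_even hq]
      refine ((double_a false).ctx [(.a, true)] [] (by simp) rfl (by simp)).trans ?_
      simpa using cancel [] [(.a, false)] .a true (by simp)
    · rw [aPow_even hq, aPow_odd hq']
      exact refl _ _
  · intro n q hq h₁ h₂ ih
    have := length_aPow_le h₁ h₂
    rw [aPow_odd hq, show 2 * q + 1 + 1 = 2 * (q + 1) by ring, aPow_even (by omega)]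
    refine ((double_a' true).ctx (L := 3 * (n + 1) + 8) [] (aPow q ++ [(.b, true)]) rfl rfl
      (by simp; omega)).trans ?_
    exact ih.ctx [(.b, false)] [(.b, true)] (by simp) (by simp) (by simp; omega)

theorem cons_aPow (c : Bool) {n : ℕ} {m : ℤ} (h : m.natAbs < 2 ^ n) :
    Conv (3 * n + 9) ((.a, c) :: aPow m) (aPow (m + sg c)) := by
  have := natAbs_lt_two_pow h
  cases c
  · have h₁ : -2 ^ n ≤ m + sg false := by simp; omega
    have h₂ : m + sg false < 2 ^ n := by simp; omega
    have hc := cons_aPow_succ h₁ h₂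
    simp only [sg_false, Int.reduceNeg, neg_add_cancel_right] at hc ⊢
    refine (hc.symm.ctx [(.a, false)] [] (by simp) rfl (by simp; omega)).trans ?_
    have := length_aPow_le h₁ h₂
    simp at this
    simpa using cancel [] (aPow (m + -1)) .a false (by simp; omega)
  · exact (cons_aPow_succ this.1.le this.2).mono (by omega)

end Conv

/-- Another word of logarithmic length representing `a ^ m`. -/
def aPow' (m : ℤ) : Word QGen := Word.inv (aPow (-m))

@[simp] theorem aPow'_zero : aPow' 0 = [] := by simp [aPow']

theorem length_aPow'_le_of_natAbs {n : ℕ} {m : ℤ} (h : m.natAbs < 2 ^ n) :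
    (aPow' m).length ≤ 3 * n + 1 := by
  simpa [aPow'] using length_aPow_le_of_natAbs (m := -m) (by simpa)

namespace Conv

theorem aPow'_snoc (c : Bool) {n : ℕ} {m : ℤ} (h : m.natAbs < 2 ^ n) :
    Conv (3 * n + 9) (aPow' m ++ [(.a, c)]) (aPow' (m + sg c)) := by
  have := (cons_aPow (!c) (n := n) (m := -m) (by simpa)).inv
  simp only [inv_cons, Bool.not_not, sg_not] at this
  rwa [aPow', aPow', neg_add]

/-- A power of `a` can be moved through a word commuting with `a`. -/
theorem aPow'_append_append_aPow {M n : ℕ} {X : Word QGen} (hX : X.length ≤ M)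
    (h : ∀ c, Conv M (X ++ [(.a, c)]) ((.a, c) :: X)) {m d : ℤ}
    (hmd : m.natAbs + d.natAbs < 2 ^ n) :
    Conv (6 * n + M + 20) (aPow' m ++ X ++ aPow d) (aPow' (m + d) ++ X) := by
  induction hk : d.natAbs generalizing m d with
  | zero =>
    obtain rfl : d = 0 := by omega
    exact of_eq _ (by simp)
  | succ k ih =>
    obtain ⟨c, d, rfl, hd⟩ : ∃ c d', d = d' + sg c ∧ d'.natAbs = k := by
      obtain h | h : 0 < d ∨ d < 0 := by omega
      · exact ⟨true, d - 1, by simp, by omega⟩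
      · exact ⟨false, d + 1, by simp, by omega⟩
    have hsg := natAbs_sg c
    have h1 := length_aPow'_le_of_natAbs (n := n) (m := m) (by omega)
    have h2 := length_aPow_le_of_natAbs (n := n) (m := d) (by omega)
    refine ((cons_aPow c (n := n) (m := d) (by omega)).symm.ctx (aPow' m ++ X) [] (by simp) rfl
      (by simp; omega)).trans ?_
    refine ((h c).ctx (aPow' m) (aPow d) (by simp) rfl (by omega)).trans ?_
    refine ((aPow'_snoc c (n := n) (m := m) (by omega)).ctx [] (X ++ aPow d) (by simp) rfl
      (by simp; omega)).trans ?_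
    have := ih (m := m + sg c) (d := d) (by omega) hd
    rw [show m + sg c + d = m + (d + sg c) by ring] at this
    simpa using this

theorem aPow_aPow' {n : ℕ} {m : ℤ} (h : m.natAbs < 2 ^ n) :
    Conv (6 * n + 22) (aPow m) (aPow' m) := by
  simpa using aPow'_append_append_aPow (M := 2) (X := []) (m := 0) (d := m) (n := n) (by simp)
    (fun c => refl _ _) (by simpa)

theorem aPow_add {n : ℕ} {m d : ℤ} (h : m.natAbs + d.natAbs < 2 ^ n) :
    Conv (9 * n + 23) (aPow m ++ aPow d) (aPow (m + d)) := by
  have h2 := length_aPow_le_of_natAbs (n := n) (m := d) (by omega)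
  refine ((aPow_aPow' (n := n) (m := m) (by omega)).ctx [] (aPow d) (by simp) rfl
    (by simp; omega)).trans ?_
  have := aPow'_append_append_aPow (M := 2) (X := []) (m := m) (d := d) (n := n) (by simp)
    (fun c => refl _ _) h
  simp only [List.append_nil, List.nil_append] at this ⊢
  exact (this.mono (by omega)).trans
    ((aPow_aPow' (n := n) (m := m + d) (by omega)).symm.mono (by omega))

theorem append_aPow_comm {M n : ℕ} {X : Word QGen} (hX : X.length ≤ M)
    (h : ∀ c, Conv M (X ++ [(.a, c)]) ((.a, c) :: X)) {d : ℤ} (hd : d.natAbs < 2 ^ n) :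
    Conv (6 * n + M + 22) (X ++ aPow d) (aPow d ++ X) := by
  have := aPow'_append_append_aPow (n := n) (m := 0) (d := d) hX h (by simpa)
  simp only [aPow'_zero, List.nil_append, zero_add] at this
  refine (this.mono (by omega)).trans
    ((aPow_aPow' hd).symm.ctx [] X (by simp) (by simp) (by simp; omega))

theorem t_aPow (e : Bool) {n : ℕ} {d : ℤ} (hd : d.natAbs < 2 ^ n) :
    Conv (6 * n + 24) ((.t, e) :: aPow d) (aPow d ++ [(.t, e)]) :=
  append_aPow_comm (M := 2) (X := [(.t, e)]) (by simp) (fun c => swap_t_a e c) hd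

end Conv

end CompressedPowers

section BaumslagSolitar

theorem inv_bpow (n : ℕ) : Word.inv (bpow n) = bpowInv n := by
  simp [Word.inv, bpow, bpowInv]

@[simp] theorem length_bpow (n : ℕ) : (bpow n).length = n := by simp [bpow]

@[simp] theorem length_bpowInv (n : ℕ) : (bpowInv n).length = n := by simp [bpowInv]

@[simp] theorem bpow_zero : bpow 0 = [] := rfl

@[simp] theorem bpowInv_zero : bpowInv 0 = [] := rfl

theorem bpow_succ (n : ℕ) : bpow (n + 1) = bpow n ++ [(.b, true)] := List.replicate_succ'

theorem bpowInv_succ (n : ℕ) : bpowInv (n + 1) = bpowInv n ++ [(.b, false)] :=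
  List.replicate_succ'

theorem bpowInv_succ' (n : ℕ) : bpowInv (n + 1) = (.b, false) :: bpowInv n := rfl

namespace Conv

theorem b_conj_aPow {n : ℕ} {m : ℤ} (h : m.natAbs < 2 ^ n) :
    Conv (3 * n + 3) ((.b, false) :: aPow m ++ [(.b, true)]) (aPow (2 * m)) := by
  by_cases hm : m = 0
  · subst hm
    simpa using cancel' [] [] .b true (by simp)
  · exact of_eq _ (aPow_even hm).symm

theorem bpowInv_a (j : ℕ) (c : Bool) :
    Conv (4 * j + 20) (bpowInv j ++ [(.a, c)]) (aPow (sg c * 2 ^ j) ++ bpowInv j) := by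
  induction j with
  | zero => simpa using (cons_aPow c (n := 0) (m := 0) (by simp)).mono (by omega)
  | succ j ih =>
    have hq : (sg c * 2 ^ j).natAbs < 2 ^ (j + 1) := by
      rw [Int.natAbs_mul, Int.natAbs_pow]
      simp [pow_succ]
    have := length_aPow_le_of_natAbs hq
    generalize hL : 4 * (j + 1) + 20 = L
    calc Conv L (bpowInv (j + 1) ++ [(.a, c)])
          ((.b, false) :: aPow (sg c * 2 ^ j) ++ bpowInv j) :=
          ih.ctx [(.b, false)] [] (by simp [bpowInv_succ']) (by simp) (by simp; omega)
      Conv L _ ((.b, false) :: aPow (sg c * 2 ^ j) ++ [(.b, true), (.b, false)] ++ bpowInv j) := by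
          simpa using (cancel ((.b, false) :: aPow (sg c * 2 ^ j)) (bpowInv j) .b true
            (by simp; omega)).symm
      Conv L _ (aPow (sg c * 2 ^ (j + 1)) ++ bpowInv (j + 1)) :=
          (b_conj_aPow hq).ctx [] (bpowInv (j + 1)) (by simp [bpowInv_succ'])
            (by simp [pow_succ]; ring_nf) (by simp; omega)

end Conv

theorem exists_conv_bpow_aPow_bpowInv {u : Word QGen} (ht : Avoids .t u) (hr : Avoids .r u)
    (hs : Avoids .s u) :
    ∃ (i j : ℕ) (m : ℤ), i ≤ u.length ∧ m.natAbs + 2 ^ j ≤ 2 ^ u.length ∧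
      Conv (12 * u.length + 60) u (bpow i ++ aPow m ++ bpowInv j) := by
  induction u using List.reverseRecOn with
  | nil => exact ⟨0, 0, 0, by simp, by simp, by simp; rfl⟩
  | append_singleton u x ih =>
    simp only [avoids_append] at ht hr hs
    obtain ⟨i, j, m, hi, hm, hc⟩ := ih ht.1 hr.1 hs.1
    have hj : j ≤ u.length := (Nat.pow_le_pow_iff_right (a := 2) (by simp)).1 (by omega)
    have hm' : m.natAbs < 2 ^ u.length := by have := Nat.one_le_two_pow (n := j); omega
    have hN := length_aPow_le_of_natAbs hm'
    generalize hL : 12 * (u ++ [x]).length + 60 = L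
    rw [List.length_append, List.length_singleton] at hL
    have h₁ : Conv L (u ++ [x])
        (bpow i ++ aPow m ++ bpowInv j ++ [x]) :=
      hc.ctx [] [x] (by simp) (by simp) (by simp; omega)
    obtain ⟨x, c⟩ := x
    cases x with
    | t => simp at ht
    | r => simp at hr
    | s => simp at hs
    | a =>
      have hq : (sg c * 2 ^ j).natAbs = 2 ^ j := by
        rw [Int.natAbs_mul, Int.natAbs_pow]
        simp
      refine ⟨i, j, m + sg c * 2 ^ j, by simp; omega, by simp [pow_succ]; omega, h₁.trans ?_⟩
      calc Conv L (bpow i ++ aPow m ++ bpowInv j ++ [(.a, c)])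
            (bpow i ++ aPow m ++ aPow (sg c * 2 ^ j) ++ bpowInv j) :=
            (Conv.bpowInv_a j c).ctx (bpow i ++ aPow m) [] (by simp) (by simp) (by simp; omega)
        Conv L _ _ :=
            (Conv.aPow_add (n := u.length + 1) (m := m) (d := sg c * 2 ^ j)
              (by rw [pow_succ]; omega)).ctx (bpow i) (bpowInv j)
              (by simp) (by simp) (by simp; omega)
    | b =>
      cases c with
      | false =>
        refine ⟨i, j + 1, m, by simp; omega, by simp [pow_succ]; omega, h₁.trans ?_⟩
        exact Conv.of_eq _ (by simp [bpowInv_succ])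
      | true =>
        cases j with
        | zero =>
          refine ⟨i + 1, 0, 2 * m, by simpa using hi, ?_, h₁.trans ?_⟩
          · simp [pow_succ, Int.natAbs_mul] at hm ⊢
            omega
          calc Conv L
                (bpow i ++ aPow m ++ bpowInv 0 ++ [(.b, true)])
                (bpow i ++ [(.b, true), (.b, false)] ++ aPow m ++ [(.b, true)]) := by
                simpa using (Conv.cancel (L := L) (bpow i) (aPow m ++ [(.b, true)]) .b true
                  (by simp; omega)).symm
            Conv L _ _ :=
                (Conv.b_conj_aPow hm').ctx (bpow (i + 1)) [] (by simp [bpow_succ]) (by simp)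
                  (by simp; omega)
        | succ j =>
          refine ⟨i, j, m, by simp; omega, ?_, h₁.trans ?_⟩
          · rw [pow_succ] at hm
            simp [pow_succ]
            omega
          simpa [bpowInv_succ] using Conv.cancel' (bpow i ++ aPow m ++ bpowInv j) [] .b true
            (by simp; omega)

namespace QGroup

theorem val_assignBS_bpow (i : ℕ) (y : ℚ) : val assignBS (bpow i) y = y / 2 ^ i := by
  induction i generalizing y with
  | zero => simp
  | succ i ih =>
    rw [bpow_succ]
    simp [ih, assignBS, pow_succ]
    ring

end QGroup

open QGroup

/-- Null-homotopic words of the Baumslag–Solitar group can be filled in linear space. -/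
theorem conv_nil_of_val_assignBS {u : Word QGen} (ht : Avoids .t u) (hr : Avoids .r u)
    (hs : Avoids .s u) (hu : val assignBS u = 1) : Conv (12 * u.length + 60) u [] := by
  obtain ⟨i, j, m, hi, hm, hc⟩ := exists_conv_bpow_aPow_bpowInv ht hr hs
  have hval := hc.val_eq isModel_assignBS
  have hb : assignBS .a * assignBS .b = assignBS .b * (assignBS .a * assignBS .a) := assignBS_conj
  rw [hu, val_append, val_append, ← inv_bpow j, val_inv, eq_mul_inv_iff_mul_eq, one_mul,
    val_aPow _ (by rw [mul_assoc, hb, inv_mul_cancel_left])] at hval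
  have h (y : ℚ) : y / 2 ^ j = (y + m) / 2 ^ i := by
    simpa [val_assignBS_bpow, assignBS_a_zpow] using congrArg (fun f : Equiv.Perm ℚ => f y) hval
  have hm0 : m = 0 := by simpa using (h 0).symm
  subst hm0
  have hij : i = j := by
    have := h 1
    simp only [Int.cast_zero, add_zero, one_div, inv_inj] at this
    exact (pow_right_injective₀ (by norm_num) (by norm_num) this).symm
  subst hij
  refine hc.trans ?_
  simpa [inv_bpow] using Conv.mul_inv_cancel (bpow i) (by simp; omega)

end BaumslagSolitar

section Fillings

theorem Word.val_flatten_replicate {X G : Type*} [Group G] (g : X → G) (n : ℕ) (u : Word X) :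
    val g (List.replicate n u).flatten = val g u ^ n := by
  induction n with
  | zero => simp
  | succ n ih => simp [List.replicate_succ, ih, pow_succ']

theorem Word.val_pinch {X G : Type*} [Group G] [DecidableEq X] {g : X → G} {A : Subgroup G}
    {x : X} (e : Bool) {κ : Word X} (h : Avoids x κ) (hA : val g κ ∈ A) :
    val (stableAssign g A x) ((x, e) :: κ ++ [(x, !e)]) = val (stableAssign g A x) κ := by
  have := (commute_stableAssign g A x e hA).eq
  rw [← val_stableAssign_of_avoids g A x h] at this
  rw [List.cons_append, val_cons, val_append, ← mul_assoc, this]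
  simp

/-- If words over the base group can be filled in linear space and pinches can be removed in
linear space, then words over a central HNN extension can be filled in linear space. -/
theorem conv_nil_of_val_stableAssign {G : Type*} [Group G] {g : QGen → G} {A : Subgroup G}
    {x : QGen} {S : Set QGen} {C D : ℕ} (hC : 1 ≤ C)
    (base : ∀ u, Avoids x u → (∀ y ∈ S, Avoids y u) → val g u = 1 → Conv (C * u.length + D) u [])
    (pinch : ∀ κ e, Avoids x κ → (∀ y ∈ S, Avoids y κ) → val g κ ∈ A →
      Conv (C * κ.length + D) ((x, e) :: κ ++ [(x, !e)]) κ)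
    (w : Word QGen) (hS : ∀ y ∈ S, Avoids y w) (hw : val (stableAssign g A x) w = 1) :
    Conv (C * w.length + D) w [] := by
  induction hn : w.length using Nat.strong_induction_on generalizing w with
  | _ n ih =>
    subst hn
    by_cases hx : Avoids x w
    · rw [val_stableAssign_of_avoids g A x hx] at hw
      exact base w hx hS (HNNExtension.of_injective (MulEquiv.refl A) (hw.trans (map_one _).symm))
    · obtain ⟨p, e, κ, q, rfl, hκ, hA⟩ := hasPinch_of_val_eq_one hw hx
      have hSκ : ∀ y ∈ S, Avoids y p ∧ Avoids y κ ∧ Avoids y q := by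
        intro y hy
        have := hS y hy
        simp only [avoids_append, avoids_cons] at this
        tauto
      have hlen : (p ++ (x, e) :: κ ++ (x, !e) :: q).length = p.length + κ.length + q.length + 2 := by
        simp
        omega
      have hp := val_pinch (g := g) e hκ hA
      have h₁ : Conv (C * (p ++ (x, e) :: κ ++ (x, !e) :: q).length + D)
          (p ++ (x, e) :: κ ++ (x, !e) :: q) (p ++ κ ++ q) := by
        refine (pinch κ e hκ (fun y hy => (hSκ y hy).2.1) hA).ctx p q (by simp) rfl ?_
        rw [hlen]
        nlinarith
      refine h₁.trans ((ih _ ?_ (p ++ κ ++ q) ?_ ?_ rfl).mono ?_)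
      · rw [hlen]
        simp
        omega
      · intro y hy
        simpa using ⟨(hSκ y hy).1, (hSκ y hy).2⟩
      · rw [← hw, show p ++ (x, e) :: κ ++ (x, !e) :: q = p ++ ((x, e) :: κ ++ [(x, !e)]) ++ q by
          simp]
        simp only [val_append] at hp ⊢
        rw [hp]
      · rw [hlen]
        simp only [List.length_append]
        nlinarith

/-- The word `t ^ k`. -/
def tPow (k : ℤ) : Word QGen := List.replicate k.natAbs (.t, decide (0 ≤ k))

/-- The word `(a t) ^ k`. -/
def atPow (k : ℤ) : Word QGen := (List.replicate k.natAbs (atWord (decide (0 ≤ k)))).flatten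

@[simp] theorem length_tPow (k : ℤ) : (tPow k).length = k.natAbs := by simp [tPow]

@[simp] theorem length_atPow (k : ℤ) : (atPow k).length = 2 * k.natAbs := by
  simp [atPow, mul_comm]

theorem avoids_tPow {x : QGen} (h : x ≠ .t) (k : ℤ) : Avoids x (tPow k) :=
  avoids_replicate_self _ _ _ h.symm

theorem avoids_atPow {x : QGen} (h : x ≠ .t) (h' : x ≠ .a) (k : ℤ) : Avoids x (atPow k) := by
  intro p hp
  simp only [atPow, List.mem_flatten, List.mem_replicate] at hp
  obtain ⟨l, ⟨-, rfl⟩, hp⟩ := hp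
  generalize decide (0 ≤ k) = c at hp
  cases c <;> simp [atWord] at hp <;> obtain rfl | rfl := hp <;> simp [h.symm, h'.symm]

theorem val_tPow {G : Type*} [Group G] (g : QGen → G) (k : ℤ) : val g (tPow k) = g .t ^ k := by
  have := val_flatten_replicate g k.natAbs [(.t, decide (0 ≤ k))]
  rw [List.flatten_replicate_singleton] at this
  rw [tPow, this]
  obtain h | h := le_or_gt 0 k
  · lift k to ℕ using h
    simp
  · obtain ⟨n, rfl⟩ : ∃ n : ℕ, k = -n := ⟨k.natAbs, by omega⟩
    have : n ≠ 0 := by omega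
    simp [this]

theorem val_atPow {G : Type*} [Group G] (g : QGen → G) (k : ℤ) :
    val g (atPow k) = (g .a * g .t) ^ k := by
  rw [atPow, val_flatten_replicate]
  obtain h | h := le_or_gt 0 k
  · lift k to ℕ using h
    simp [atWord]
  · obtain ⟨n, rfl⟩ : ∃ n : ℕ, k = -n := ⟨k.natAbs, by omega⟩
    have : n ≠ 0 := by omega
    simp [this, atWord, ← inv_pow]

theorem QGroup.IsModel.val_aPow {G : Type*} [Group G] {g : QGen → G} (hg : QGroup.IsModel g)
    (m : ℤ) : val g (aPow m) = g .a ^ m :=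
  _root_.val_aPow g (by rw [mul_assoc, hg.conj, inv_mul_cancel_left]) m

open QGroup

theorem conv_t_pinch (κ : Word QGen) (e : Bool) (ht : Avoids .t κ)
    (hS : ∀ y ∈ ({.r, .s} : Set QGen), Avoids y κ) (hA : val assignBS κ ∈ centT) :
    Conv (52 * κ.length + 90) ((.t, e) :: κ ++ [(.t, !e)]) κ := by
  obtain ⟨k, hk⟩ := Subgroup.mem_zpowers_iff.1 hA
  have hr := hS .r (by simp)
  have hs := hS .s (by simp)
  have hkl := abs_lt_of_val_assignBS hk.symm
  have hkl : k.natAbs < 2 ^ κ.length := by zify; exact hkl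
  have hlen := length_aPow_le_of_natAbs hkl
  have hκ : Conv (52 * κ.length + 80) κ (aPow k) := by
    refine Conv.of_mul_inv (M := 48 * κ.length + 72) ((conv_nil_of_val_assignBS ?_ ?_ ?_ ?_).mono ?_)
      (by omega) (by omega)
    · simpa using ⟨ht, avoids_aPow (by simp) (by simp) k⟩
    · simpa using ⟨hr, avoids_aPow (by simp) (by simp) k⟩
    · simpa using ⟨hs, avoids_aPow (by simp) (by simp) k⟩
    · rw [val_append, val_inv, isModel_assignBS.val_aPow, hk, mul_inv_cancel]
    · simp
      omega
  generalize hL : 52 * κ.length + 90 = L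
  calc Conv L ((.t, e) :: κ ++ [(.t, !e)]) ((.t, e) :: aPow k ++ [(.t, !e)]) :=
        hκ.ctx [(.t, e)] [(.t, !e)] (by simp) (by simp) (by simp; omega)
    Conv L _ (aPow k ++ [(.t, e), (.t, !e)]) :=
        (Conv.t_aPow e hkl).ctx [] [(.t, !e)] (by simp) (by simp) (by simp; omega)
    Conv L _ (aPow k) := by simpa using Conv.cancel (L := L) (aPow k) [] .t e (by simp; omega)
    Conv L _ κ := hκ.symm.mono (by omega)

/-- Null-homotopic words avoiding `r` and `s` can be filled in linear space. -/
theorem conv_nil_of_val_assignT {u : Word QGen} (hr : Avoids .r u) (hs : Avoids .s u)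
    (hu : val assignT u = 1) : Conv (52 * u.length + 90) u [] := by
  refine conv_nil_of_val_stableAssign (S := {.r, .s}) (by simp) ?_ conv_t_pinch u
    (by simpa using ⟨hr, hs⟩) hu
  intro u ht hS hu
  exact (conv_nil_of_val_assignBS ht (hS .r (by simp)) (hS .s (by simp)) hu).mono (by omega)

namespace Conv

theorem r_atPow (e : Bool) (k : ℤ) :
    Conv (2 * k.natAbs + 1) ((.r, e) :: atPow k) (atPow k ++ [(.r, e)]) := by
  rw [atPow]
  generalize k.natAbs = n
  induction n with
  | zero => exact of_eq _ (by simp)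
  | succ n ih =>
    generalize hL : 2 * (n + 1) + 1 = L
    generalize decide (0 ≤ k) = c at *
    rw [List.replicate_succ, List.flatten_cons]
    calc Conv L _ (atWord c ++ (.r, e) :: (List.replicate n (atWord c)).flatten) :=
          (swap_r_at e c).ctx [] _ (by simp; rfl) (by simp) (by simp; omega)
      Conv L _ _ := ih.ctx (atWord c) [] (by simp) (by simp) (by simp; omega)

end Conv

theorem exists_conv_atPow {κ : Word QGen} (hr : Avoids .r κ) (hs : Avoids .s κ)
    (hA : val assignT κ ∈ centR) :
    ∃ k : ℤ, k.natAbs ≤ κ.length ∧ val assignT κ = (assignT .a * assignT .t) ^ k ∧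
      Conv (158 * κ.length + 90) κ (atPow k) := by
  obtain ⟨k, hk⟩ := Subgroup.mem_zpowers_iff.1 hA
  have hk' := commute_assignT.symm.mul_zpow k
  have hkl := (bounds_of_val_assignT (hk.symm.trans hk')).2
  have hkl : k.natAbs ≤ κ.length := by zify; exact hkl
  refine ⟨k, hkl, hk.symm, ?_⟩
  refine Conv.of_mul_inv (M := 156 * κ.length + 90) ((conv_nil_of_val_assignT ?_ ?_ ?_).mono ?_)
    (by simp; omega) (by simp; omega)
  · simpa using ⟨hr, avoids_atPow (by simp) (by simp) k⟩
  · simpa using ⟨hs, avoids_atPow (by simp) (by simp) k⟩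
  · rw [val_append, val_inv, val_atPow, hk, mul_inv_cancel]
  · simp
    omega

theorem conv_r_pinch (κ : Word QGen) (e : Bool) (hr : Avoids .r κ)
    (hS : ∀ y ∈ ({.s} : Set QGen), Avoids y κ) (hA : val assignT κ ∈ centR) :
    Conv (158 * κ.length + 100) ((.r, e) :: κ ++ [(.r, !e)]) κ := by
  obtain ⟨k, hkl, -, hκ⟩ := exists_conv_atPow hr (hS .s (by simp)) hA
  generalize hL : 158 * κ.length + 100 = L
  calc Conv L ((.r, e) :: κ ++ [(.r, !e)]) ((.r, e) :: atPow k ++ [(.r, !e)]) :=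
        hκ.ctx [(.r, e)] [(.r, !e)] (by simp) (by simp) (by simp; omega)
    Conv L _ (atPow k ++ [(.r, e), (.r, !e)]) :=
        (Conv.r_atPow e k).ctx [] [(.r, !e)] (by simp) (by simp) (by simp; omega)
    Conv L _ (atPow k) := by simpa using Conv.cancel (L := L) (atPow k) [] .r e (by simp; omega)
    Conv L _ κ := hκ.symm.mono (by omega)

/-- Null-homotopic words avoiding `s` can be filled in linear space. -/
theorem conv_nil_of_val_assignR {u : Word QGen} (hs : Avoids .s u)
    (hu : val assignR u = 1) : Conv (158 * u.length + 100) u [] := by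
  refine conv_nil_of_val_stableAssign (S := {.s}) (by simp) ?_ conv_r_pinch u (by simpa) hu
  intro u hr hS hu
  exact (conv_nil_of_val_assignT hr (hS .s (by simp)) hu).mono (by omega)

end Fillings

section Fragmentation

@[simp] theorem totalLength_nil {A : Type*} : totalLength ([] : List (Word A)) = 0 := rfl

@[simp] theorem totalLength_cons {A : Type*} (u : Word A) (l : List (Word A)) :
    totalLength (u :: l) = u.length + totalLength l := by simp [totalLength]

@[simp] theorem totalLength_append {A : Type*} (l₁ l₂ : List (Word A)) :
    totalLength (l₁ ++ l₂) = totalLength l₁ + totalLength l₂ := by simp [totalLength]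

/-- The sequence `l` can be converted to `l'` by moves (i)–(v) in total length at most `L`. -/
def SeqConv (L : ℕ) : List (Word QGen) → List (Word QGen) → Prop :=
  Relation.ReflTransGen fun l l' => MoveF QRels l l' ∧ totalLength l ≤ L ∧ totalLength l' ≤ L

namespace SeqConv

variable {L M : ℕ} {l l' l'' : List (Word QGen)}

theorem refl (L : ℕ) (l : List (Word QGen)) : SeqConv L l l := Relation.ReflTransGen.refl

theorem of_move (h : MoveF QRels l l') (hl : totalLength l ≤ L) (hl' : totalLength l' ≤ L) :
    SeqConv L l l' :=
  Relation.ReflTransGen.single ⟨h, hl, hl'⟩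

theorem trans (h₁ : SeqConv L l l') (h₂ : SeqConv L l' l'') : SeqConv L l l'' :=
  Relation.ReflTransGen.trans h₁ h₂

theorem ctx (h : SeqConv M l l') (p q : List (Word QGen))
    (hL : totalLength p + M + totalLength q ≤ L) : SeqConv L (p ++ l ++ q) (p ++ l' ++ q) := by
  induction h with
  | refl => exact refl L _
  | tail _ h ih =>
    obtain ⟨hm, h₁, h₂⟩ := h
    refine ih.trans (of_move ?_ (by simp; omega) (by simp; omega))
    cases hm with
    | of l₁ l₂ h => simpa using MoveF.of (p ++ l₁) (l₂ ++ q) h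
    | frag l₁ l₂ u v => simpa using MoveF.frag (R := QRels) (p ++ l₁) (l₂ ++ q) u v

theorem of_conv {u v : Word QGen} (h : Conv L u v) : SeqConv L [u] [v] := by
  induction h with
  | refl => exact refl L _
  | tail _ h ih =>
    exact ih.trans (of_move (.of [] [] (.of h.1)) (by simpa using h.2.1) (by simpa using h.2.2))

end SeqConv

/-- `w` can be filled by moves (i)–(v) in total length at most `L`. -/
def Fillable (L : ℕ) (w : Word QGen) : Prop :=
  w.length ≤ L ∧ ∃ l, SeqConv L [w] l ∧ ∀ u ∈ l, u = []

theorem totalLength_eq_zero {A : Type*} {l : List (Word A)} (h : ∀ u ∈ l, u = []) :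
    totalLength l = 0 := by
  simp only [totalLength, List.sum_eq_zero_iff, List.mem_map, forall_exists_index, and_imp]
  rintro _ u hu rfl
  simp [h u hu]

namespace Fillable

variable {L M : ℕ} {u v : Word QGen}

theorem nil (L : ℕ) : Fillable L [] := ⟨by simp, [[]], SeqConv.refl _ _, by simp⟩

theorem mono (h : Fillable M u) (hL : M ≤ L) : Fillable L u := by
  obtain ⟨h, l, hl, hl'⟩ := h
  exact ⟨h.trans hL, l, by simpa using hl.ctx (L := L) [] [] (by simpa), hl'⟩

theorem of_conv (h : Conv L u v) (hv : Fillable L v) : Fillable L u := by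
  obtain ⟨h', l, hl, hl'⟩ := hv
  refine ⟨?_, l, (SeqConv.of_conv h).trans hl, hl'⟩
  obtain rfl | ⟨_, h, -⟩ := Relation.ReflTransGen.cases_head h
  · exact h'
  · exact h.2.1

theorem rotate (h : Fillable L (u ++ v)) : Fillable L (v ++ u) := by
  obtain ⟨h', l, hl, hl'⟩ := h
  have h'' : (v ++ u).length ≤ L := by simp at h' ⊢; omega
  exact ⟨h'', l, (SeqConv.of_move (.of [] [] (.cyc ⟨v, u, rfl, rfl⟩)) (by simpa using h'')
    (by simpa using h')).trans hl, hl'⟩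

theorem append_left (hu : Fillable M u) (hv : Fillable L v) (hL : M + v.length ≤ L) :
    Fillable L (u ++ v) := by
  obtain ⟨hlu, l, hl, hl'⟩ := hu
  obtain ⟨-, k, hk, hk'⟩ := hv
  refine ⟨by simp; omega, l ++ k, ?_, ?_⟩
  · refine (SeqConv.of_move (.frag [] [] u v) (by simp; omega) (by simp; omega)).trans ?_
    refine (hl.ctx [] [v] (by simpa)).trans ?_
    simpa using hk.ctx l [] (by simp [totalLength_eq_zero hl'])
  · simpa [or_imp, forall_and] using ⟨hl', hk'⟩

theorem append_right (hu : Fillable L u) (hv : Fillable M v) (hL : u.length + M ≤ L) :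
    Fillable L (u ++ v) :=
  (hv.append_left hu (by omega)).rotate

theorem fffle (h : Fillable L u) : FFFLle QRels u L := by
  obtain ⟨h', l, hl, hl'⟩ := h
  have key : ∃ (m : ℕ) (f : ℕ → List (Word QGen)), f 0 = [u] ∧ f m = l ∧
      (∀ i < m, MoveF QRels (f i) (f (i + 1))) ∧ ∀ i ≤ m, totalLength (f i) ≤ L := by
    clear hl'
    induction hl with
    | refl => exact ⟨0, fun _ => [u], rfl, rfl, by simp, by simpa⟩
    | @tail l₁ l₂ _ hs ih =>
      obtain ⟨m, f, h0, hm, hf, hL⟩ := ih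
      refine ⟨m + 1, fun i => if i ≤ m then f i else l₂, by simpa, by simp, ?_, ?_⟩
      · intro i hi
        obtain hi | rfl := Nat.lt_succ_iff_lt_or_eq.1 hi
        · simpa [hi.le, Nat.succ_le_of_lt hi] using hf i hi
        · simpa [hm] using hs.1
      · intro i hi
        by_cases h : i ≤ m
        · simpa [h] using hL i h
        · simpa [h] using hs.2.2
  obtain ⟨m, f, h0, hm, hf, hL⟩ := key
  exact ⟨m, f, h0, by simpa [hm] using hl', hf, hL⟩

end Fillable

/-- The commutator-like word `s^e x s^{-e} x⁻¹`. -/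
def sComm (e : Bool) (x : Word QGen) : Word QGen := (.s, e) :: x ++ (.s, !e) :: Word.inv x

@[simp] theorem length_sComm (e : Bool) (x : Word QGen) :
    (sComm e x).length = 2 * x.length + 2 := by
  simp [sComm]
  omega

namespace Conv

theorem sComm (e : Bool) {L M : ℕ} {x y : Word QGen} (h : Conv M x y) (hx : M + x.length + 2 ≤ L)
    (hy : M + y.length + 2 ≤ L) : Conv L (sComm e x) (sComm e y) := by
  calc Conv L (_root_.sComm e x) ((.s, e) :: y ++ (.s, !e) :: Word.inv x) :=
        h.ctx [(.s, e)] ((.s, !e) :: Word.inv x) (by simp [_root_.sComm]) (by simp)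
          (by simp; omega)
    Conv L _ (_root_.sComm e y) :=
        h.inv.ctx ((.s, e) :: y ++ [(.s, !e)]) [] (by simp) (by simp [_root_.sComm])
          (by simp; omega)

theorem s_pinch (e : Bool) {x : Word QGen} (ha : Avoids .a x) (hb : Avoids .b x)
    (hs : Avoids .s x) : Conv (x.length + 2) ((.s, e) :: x ++ [(.s, !e)]) x := by
  induction x with
  | nil => simpa using cancel (L := 2) [] [] .s e (by simp)
  | cons p x ih =>
    simp only [avoids_cons] at ha hb hs
    generalize hL : (p :: x).length + 2 = L
    rw [List.length_cons] at hL
    have hswap : Conv 2 [(.s, e), p] [p, (.s, e)] := by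
      obtain ⟨y, c⟩ := p
      cases y with
      | r => exact swap_s_r e c
      | t => exact swap_s_t e c
      | _ => simp at ha hb hs
    calc Conv L _ (p :: (.s, e) :: x ++ [(.s, !e)]) :=
          hswap.ctx [] (x ++ [(.s, !e)]) (by simp) (by simp) (by simp; omega)
      Conv L _ (p :: x) := (ih ha.2 hb.2 hs.2).ctx [p] [] (by simp) (by simp) (by simp; omega)

theorem sComm_append (e : Bool) (x y : Word QGen) {L : ℕ}
    (hL : 4 * x.length + 2 * y.length + 4 ≤ L) :
    Conv L (_root_.sComm e (x ++ y)) (_root_.sComm e x ++ (x ++ _root_.sComm e y ++ Word.inv x)) := by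
  refine Conv.symm ?_
  calc Conv L (_root_.sComm e x ++ (x ++ _root_.sComm e y ++ Word.inv x))
        ((.s, e) :: x ++ (.s, !e) :: (.s, e) :: y ++ (.s, !e) :: Word.inv y ++ Word.inv x) :=
        (inv_mul_cancel x le_rfl).ctx ((.s, e) :: x ++ [(.s, !e)])
          ((.s, e) :: y ++ (.s, !e) :: Word.inv y ++ Word.inv x) (by simp [_root_.sComm])
          (by simp) (by simp; omega)
    Conv L _ (_root_.sComm e (x ++ y)) := by
        simpa [_root_.sComm] using cancel' ((.s, e) :: x) (y ++ (.s, !e) :: Word.inv y ++ Word.inv x)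
          .s e (by simp; omega)

end Conv

namespace Fillable

variable {L M : ℕ} {x y : Word QGen} {e : Bool}

theorem conj (h : Fillable L y) (hL : 2 * x.length + y.length ≤ L) :
    Fillable L (x ++ y ++ Word.inv x) := by
  rw [List.append_assoc]
  refine rotate (of_conv (Conv.ctx (Conv.inv_mul_cancel x le_rfl) y [] (by simp) rfl ?_) ?_)
  · simp
    omega
  · simpa

theorem sComm_append_left (hx : Fillable M (sComm e x)) (hy : Fillable L (sComm e y))
    (h₁ : M + 2 * x.length + 2 * y.length + 2 ≤ L) (h₂ : 4 * x.length + 2 * y.length + 4 ≤ L) :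
    Fillable L (sComm e (x ++ y)) :=
  of_conv (Conv.sComm_append e x y h₂)
    (hx.append_left (hy.conj (by simp; omega)) (by simp; omega))

theorem sComm_append_right (hx : Fillable L (sComm e x)) (hy : Fillable M (sComm e y))
    (h₁ : M + 2 * x.length + 2 ≤ L) (h₂ : 4 * x.length + 2 * y.length + 4 ≤ L) :
    Fillable L (sComm e (x ++ y)) :=
  of_conv (Conv.sComm_append e x y h₂)
    (hx.append_right ((hy.mono (le_max_left M (2 * x.length + 2 * y.length + 2))).conj
      (by simp; omega)) (by simp; omega))

theorem sComm_of_avoids (e : Bool) (ha : Avoids .a x) (hb : Avoids .b x) (hs : Avoids .s x)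
    (hL : 2 * x.length + 2 ≤ L) : Fillable L (sComm e x) := by
  refine of_conv ?_ (nil L)
  calc Conv L (sComm e x) (x ++ Word.inv x) :=
        (Conv.s_pinch e ha hb hs).ctx [] (Word.inv x) (by simp [sComm]) (by simp)
          (by simp; omega)
    Conv L _ [] := Conv.mul_inv_cancel x (by omega)

theorem sComm_tPow (e : Bool) (k : ℤ) : Fillable (2 * k.natAbs + 2) (sComm e (tPow k)) :=
  sComm_of_avoids e (avoids_tPow (by simp) k) (avoids_tPow (by simp) k) (avoids_tPow (by simp) k)
    (by simp)

theorem sComm_letter (e : Bool) {z : QGen} (c : Bool) (hz : z = .r ∨ z = .t) :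
    Fillable 4 (sComm e [(z, c)]) := by
  obtain rfl | rfl := hz <;> exact sComm_of_avoids e (by simp) (by simp) (by simp) (by simp)

theorem sComm_conj_r (e ε : Bool) {n : ℕ} {p : ℤ} (hp : p.natAbs < 2 ^ n) :
    Fillable (24 * n + 80) (sComm e (aPow p ++ (.r, ε) :: aPow (-p))) := by
  induction hk : p.natAbs generalizing p with
  | zero =>
    obtain rfl : p = 0 := by omega
    simpa using (sComm_letter e ε (.inl rfl)).mono (by omega)
  | succ k ih =>
    obtain ⟨c, p, rfl, hd⟩ : ∃ c p', p = p' + sg c ∧ p'.natAbs = k := by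
      obtain h | h : 0 < p ∨ p < 0 := by omega
      · exact ⟨true, p - 1, by simp, by omega⟩
      · exact ⟨false, p + 1, by simp, by omega⟩
    have hsg := natAbs_sg c
    obtain ⟨P, hP⟩ : ∃ P, P = p + sg c := ⟨_, rfl⟩
    obtain ⟨m, hm⟩ : ∃ m, m = -p := ⟨_, rfl⟩
    obtain ⟨M, hM⟩ : ∃ M, M = -P := ⟨_, rfl⟩
    rw [← hP] at hp hk
    rw [← hP, ← hM]
    have h1 := length_aPow_le_of_natAbs (n := n) (m := p) (by omega)
    have h2 := length_aPow_le_of_natAbs (n := n) (m := m) (by omega)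
    have h3 := length_aPow_le_of_natAbs (n := n) (m := P) (by omega)
    have h4 := length_aPow_le_of_natAbs (n := n) (m := M) (by omega)
    have h5 := length_aPow'_le_of_natAbs (n := n) (m := P) (by omega)
    have h7 := length_aPow'_le_of_natAbs (n := n) (m := p) (by omega)
    have key : Conv (9 * n + 40) (aPow P ++ (.r, ε) :: aPow M)
        ([(.t, !c)] ++ ((aPow p ++ (.r, ε) :: aPow m) ++ [(.t, c)])) := by
      generalize hL : 9 * n + 40 = L
      have h6 := Conv.cons_aPow (!c) (n := n) (m := m) (by omega)
      rw [show m + sg (!c) = M by rw [sg_not]; omega] at h6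
      have h8 := Conv.aPow'_snoc (n := n) (m := p) c (by omega)
      rw [← hP] at h8
      calc Conv L (aPow P ++ (.r, ε) :: aPow M) (aPow' P ++ (.r, ε) :: aPow M) :=
            (Conv.aPow_aPow' (n := n) (m := P) (by omega)).ctx [] ((.r, ε) :: aPow M) (by simp)
              (by simp) (by simp; omega)
        Conv L _ (aPow' p ++ [(.a, c)] ++ (.r, ε) :: aPow M) :=
            h8.symm.ctx [] ((.r, ε) :: aPow M) (by simp) (by simp) (by simp; omega)
        Conv L _ (aPow p ++ [(.a, c)] ++ (.r, ε) :: aPow M) :=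
            (Conv.aPow_aPow' (n := n) (m := p) (by omega)).symm.ctx []
              ([(.a, c)] ++ (.r, ε) :: aPow M) (by simp) (by simp) (by simp; omega)
        Conv L _ (aPow p ++ [(.a, c)] ++ (.r, ε) :: (.a, !c) :: aPow m) :=
            h6.symm.ctx (aPow p ++ [(.a, c), (.r, ε)]) [] (by simp) (by simp) (by simp; omega)
        Conv L _ (aPow p ++ [(.t, !c), (.r, ε), (.t, c)] ++ aPow m) :=
            (Conv.conj_a_r ε c).ctx (aPow p) (aPow m) (by simp) (by simp) (by omega)
        Conv L _ ((.t, !c) :: aPow p ++ (.r, ε) :: (.t, c) :: aPow m) :=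
            (Conv.t_aPow (!c) (n := n) (d := p) (by omega)).symm.ctx []
              ((.r, ε) :: (.t, c) :: aPow m) (by simp) (by simp) (by simp; omega)
        Conv L _ ([(.t, !c)] ++ ((aPow p ++ (.r, ε) :: aPow m) ++ [(.t, c)])) :=
            (Conv.t_aPow c (n := n) (d := m) (by omega)).ctx ((.t, !c) :: aPow p ++ [(.r, ε)]) []
              (by simp) (by simp) (by simp; omega)
    refine of_conv (key.sComm e (by simp; omega) (by simp; omega)) ?_
    refine sComm_append_left (sComm_letter e (!c) (.inr rfl)) ?_ (by simp; omega) (by simp; omega)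
    subst hm
    exact sComm_append_right (ih (by omega) hd) (sComm_letter e c (.inr rfl)) (by simp; omega)
      (by simp; omega)

end Fillable

end Fragmentation

section TwoLetters

open QGroup

theorem List.append_eq_append_cons {α : Type*} {u v p q : List α} {y : α}
    (h : u ++ v = p ++ y :: q) :
    (∃ z, u = p ++ y :: z ∧ q = z ++ v) ∨ ∃ z, p = u ++ z ∧ v = z ++ y :: q := by
  obtain ⟨z, rfl, h'⟩ | ⟨z, rfl, h'⟩ := List.append_eq_append_iff.1 h
  · exact .inr ⟨z, rfl, h'⟩
  · obtain ⟨rfl, rfl⟩ | ⟨z', rfl, rfl⟩ := List.cons_eq_append_iff.1 h'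
    · exact .inr ⟨[], by simp⟩
    · exact .inl ⟨z', rfl, rfl⟩

theorem exists_val_eq_zpow_t {G : Type*} [Group G] (g : QGen → G) {c : Word QGen}
    (ha : Avoids .a c) (hb : Avoids .b c) (hr : Avoids .r c) (hs : Avoids .s c) :
    ∃ m : ℤ, val g c = g .t ^ m := by
  induction c with
  | nil => exact ⟨0, by simp⟩
  | cons p c ih =>
    simp only [avoids_cons] at ha hb hr hs
    obtain ⟨m, hm⟩ := ih ha.2 hb.2 hr.2 hs.2
    obtain ⟨x, e⟩ := p
    cases x with
    | t =>
      cases e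
      · exact ⟨-1 + m, by simp [hm, zpow_add]⟩
      · exact ⟨1 + m, by simp [hm, zpow_add]⟩
    | _ => simp at ha hb hr hs

theorem val_assignT_eq_of_val_assignR_eq {u v : Word QGen} (hu : Avoids .r u) (hv : Avoids .r v)
    (h : val assignR u = val assignR v) : val assignT u = val assignT v := by
  have hu' : val assignR u = HNNExtension.of (val assignT u) :=
    val_stableAssign_of_avoids assignT centR .r hu
  have hv' : val assignR v = HNNExtension.of (val assignT v) :=
    val_stableAssign_of_avoids assignT centR .r hv
  exact HNNExtension.of_injective (MulEquiv.refl centR) (hu'.symm.trans (h.trans hv'))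

theorem exists_conv_tPow_aPow {q : ℕ} {P k y : ℤ} {u : Word QGen} (hr : Avoids .r u)
    (hs : Avoids .s u) (hP : P.natAbs < 2 ^ q)
    (h : val assignT (aPow P ++ u) = assignT .a ^ k * assignT .t ^ y) :
    k.natAbs < 2 ^ (q + u.length + 1) ∧ y.natAbs ≤ u.length ∧
      Conv (500 * (q + u.length) + 500) (aPow P ++ u) (tPow y ++ aPow k) := by
  have hu : val assignT u = assignT .a ^ (-P + k) * assignT .t ^ y := by
    rw [val_append, isModel_assignT.val_aPow] at h
    rw [zpow_add, mul_assoc, ← h, zpow_neg, inv_mul_cancel_left]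
  obtain ⟨h₁, h₂⟩ := bounds_of_val_assignT hu
  have h₁ : (-P + k).natAbs < 2 ^ u.length := by zify; exact h₁
  have h₂ : y.natAbs ≤ u.length := by zify; exact h₂
  have h₃ : 2 ^ q + 2 ^ u.length ≤ 2 ^ (q + u.length + 1) := by
    have := Nat.pow_le_pow_right (n := 2) (by simp) (show q ≤ q + u.length by simp)
    have := Nat.pow_le_pow_right (n := 2) (by simp) (show u.length ≤ q + u.length by simp)
    rw [pow_succ]
    omega
  have hk : k.natAbs < 2 ^ (q + u.length + 1) := by omega
  refine ⟨hk, h₂, ?_⟩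
  have hlk := length_aPow_le_of_natAbs hk
  have hlP := length_aPow_le_of_natAbs hP
  refine Conv.of_mul_inv (M := 450 * (q + u.length) + 450)
    ((conv_nil_of_val_assignT ?_ ?_ ?_).mono ?_) (by simp; omega) (by simp; omega)
  · simpa using ⟨avoids_aPow (by simp) (by simp) P, hr, avoids_aPow (by simp) (by simp) k,
      avoids_tPow (by simp) y⟩
  · simpa using ⟨avoids_aPow (by simp) (by simp) P, hs, avoids_aPow (by simp) (by simp) k,
      avoids_tPow (by simp) y⟩
  · rw [val_append, val_inv, h, val_append, val_tPow, isModel_assignT.val_aPow,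
      (commute_assignT.zpow_zpow y k).eq, mul_inv_cancel]
  · simp
    omega

namespace Fillable

theorem sComm_of_conv {L M : ℕ} {x y : Word QGen} (e : Bool) (h : Conv M x y)
    (hx : M + x.length + 2 ≤ L) (hy : M + y.length + 2 ≤ L) (hf : Fillable L (sComm e y)) :
    Fillable L (sComm e x) :=
  of_conv (h.sComm e hx hy) hf

/-- `s` commutes in linear space with a word of the form `aPow P ++ u` representing an element of
the subgroup generated by `r` and `t`. -/
theorem sComm_aPow_append {L N : ℕ} (hL : 3000 * N + 3000 ≤ L) (e : Bool) (q : ℕ) (P : ℤ)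
    (u h : Word QGen) (hN : q + u.length ≤ N) (hP : P.natAbs < 2 ^ q) (hsu : Avoids .s u)
    (hah : Avoids .a h) (hbh : Avoids .b h) (hsh : Avoids .s h)
    (hval : val assignR h = val assignR (aPow P ++ u)) : Fillable L (sComm e (aPow P ++ u)) := by
  induction hn : toLex (u.length, h.length) using WellFoundedLT.induction generalizing q P u h with
  | _ n ih =>
  subst hn
  have hlP := length_aPow_le_of_natAbs hP
  have hPr : Avoids .r (aPow P) := avoids_aPow (by simp) (by simp) P
  have hPs : Avoids .s (aPow P) := avoids_aPow (by simp) (by simp) P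
  by_cases hr : Avoids .r (Word.inv h ++ (aPow P ++ u))
  · simp only [avoids_append, avoids_inv] at hr
    obtain ⟨m, hm⟩ := exists_val_eq_zpow_t assignT hah hbh hr.1 hsh
    rw [val_assignT_eq_of_val_assignR_eq hr.1 (by simpa using hr.2) hval] at hm
    obtain ⟨-, hlm, hc⟩ := exists_conv_tPow_aPow (k := 0) hr.2.2 hsu hP (by simpa using hm)
    refine sComm_of_conv e hc (by simp; omega) (by simp; omega) ?_
    simpa using (sComm_tPow e m).mono (by omega)
  · have hone : val assignR (Word.inv h ++ (aPow P ++ u)) = 1 := by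
      rw [val_append, val_inv, hval, inv_mul_cancel]
    obtain ⟨p, ε, κ, z, heq, hκ, hA⟩ :=
      hasPinch_of_val_eq_one (g := assignT) (A := centR) (x := .r) hone hr
    simp only [List.append_assoc, List.cons_append] at heq
    obtain ⟨c, hh, heq'⟩ | ⟨c, rfl, heq'⟩ := List.append_eq_append_cons heq
    · obtain ⟨d, rfl, rfl⟩ | ⟨d, rfl, heq''⟩ := List.append_eq_append_cons heq'.symm
      · -- both letters lie in `inv h`
        obtain rfl : h = Word.inv (p ++ (.r, ε) :: (κ ++ (.r, !ε) :: d)) := by rw [← hh]; simp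
        simp only [avoids_append, avoids_cons, avoids_inv] at hah hbh hsh
        have hc := (conv_r_pinch κ ε hκ (by simpa using hsh.2.2.1) hA).ctx p d rfl rfl le_rfl
        have := hc.val_eq isModel_assignR
        refine ih _ (by simp [Prod.Lex.toLex_lt_toLex]) q P u (Word.inv (p ++ κ ++ d))
          hN hP hsu ?_ ?_ ?_ ?_ rfl
        · simpa using ⟨hah.2.2.2.2, hah.2.2.1, hah.1⟩
        · simpa using ⟨hbh.2.2.2.2, hbh.2.2.1, hbh.1⟩
        · simpa using ⟨hsh.2.2.2.2, hsh.2.2.1, hsh.1⟩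
        · rw [← hval, val_inv, ← this, val_inv]
          simp
      · obtain ⟨f, hf, -⟩ | ⟨f, rfl, rfl⟩ := List.append_eq_append_cons heq''
        · simp [hf] at hPr
        · -- the letters lie in `inv h` and in `u`
          obtain rfl : h = Word.inv (p ++ (.r, ε) :: c) := by rw [← hh]; simp
          simp only [avoids_append, avoids_cons, avoids_inv] at hah hbh hsh hκ hsu
          have hsκ : Avoids .s (c ++ (aPow P ++ f)) := by simpa using ⟨hsh.2.2, hPs, hsu.1⟩
          have hpinch := (conv_r_pinch _ ε (by simpa using hκ) (by simpa using hsκ) hA).val_eq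
            isModel_assignR
          obtain ⟨k, -, hk, hat⟩ := exists_conv_atPow (by simpa using hκ) hsκ hA
          have hat := hat.val_eq isModel_assignR
          obtain ⟨m, hm⟩ := exists_val_eq_zpow_t assignT hah.2.2 hbh.2.2 hκ.1 hsh.2.2
          have hv : val assignT (aPow P ++ f) = assignT .a ^ k * assignT .t ^ (k - m) := by
            rw [commute_assignT.symm.mul_zpow, val_append, hm, ← eq_inv_mul_iff_mul_eq] at hk
            rw [hk, ← mul_assoc, ← zpow_neg, (commute_assignT.zpow_zpow _ _).eq, mul_assoc,
              ← zpow_add, neg_add_eq_sub]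
          obtain ⟨hlk, hly, hc⟩ := exists_conv_tPow_aPow hκ.2.2 hsu.1 hP hv
          have hlk1 := length_aPow_le_of_natAbs hlk
          have hlk2 := length_aPow_le_of_natAbs (m := -k) (n := q + f.length + 1) (by simpa)
          simp only [List.length_append, List.length_cons] at hN
          generalize hL' : 600 * (q + (f.length + (z.length + 1))) + 600 = M
          have hc' : Conv M (aPow P ++ (f ++ (.r, !ε) :: z))
              (tPow (k - m) ++ ((aPow k ++ (.r, !ε) :: aPow (-k)) ++ (aPow k ++ z))) := by
            have hcancel := Conv.aPow_add (m := -k) (d := k) (n := q + f.length + 1 + 1)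
              (by rw [pow_succ]; omega)
            rw [neg_add_cancel, aPow_zero] at hcancel
            calc Conv M _ (tPow (k - m) ++ (aPow k ++ (.r, !ε) :: z)) :=
                  hc.ctx [] ((.r, !ε) :: z) (by simp) (by simp) (by simp; omega)
              Conv M _ _ :=
                  hcancel.symm.ctx (tPow (k - m) ++ (aPow k ++ [(.r, !ε)])) z (by simp) (by simp)
                    (by simp; omega)
          refine sComm_of_conv e hc' (by simp; omega) (by simp; omega) ?_
          refine sComm_append_left (sComm_tPow e _) (sComm_append_left (sComm_conj_r e _ hlk) ?_
            (by simp; omega) (by simp; omega)) (by simp; omega) (by simp; omega)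
          refine ih _ (by simp [Prod.Lex.toLex_lt_toLex] ; omega) (q + f.length + 1) k z
            (tPow (-k) ++ Word.inv p) (by omega)
            hlk hsu.2.2 ?_ ?_ ?_ ?_ rfl
          · simpa using ⟨avoids_tPow (by simp) _, hah.1⟩
          · simpa using ⟨avoids_tPow (by simp) _, hbh.1⟩
          · simpa using ⟨avoids_tPow (by simp) _, hsh.1⟩
          · rw [val_atPow] at hat
            rw [List.cons_append, val_cons, val_append, hat] at hpinch
            simp only [val_append, val_inv, val_cons, val_nil, letterVal_not, mul_one, val_tPow,
              isModel_assignR.val_aPow, mul_inv_rev] at hval hat hpinch ⊢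
            have hp : (val assignR p)⁻¹ = (assignR .a * assignR .t) ^ k * val assignR z := by
              rw [mul_assoc, inv_mul_eq_iff_eq_mul, inv_mul_eq_iff_eq_mul] at hval
              rw [← hpinch, ← hat, hval]
              simp only [mul_assoc]
            rw [hp, commute_assignR_t_a.symm.mul_zpow, (commute_assignR_t_a.zpow_zpow _ _).symm.eq,
              mul_assoc, zpow_neg, inv_mul_cancel_left]
    · obtain ⟨d, hd, -⟩ | ⟨d, rfl, rfl⟩ := List.append_eq_append_cons heq'
      · simp [hd] at hPr
      · -- both letters lie in `u`
        simp only [avoids_append, avoids_cons] at hsu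
        have hc := (conv_r_pinch κ ε hκ (by simpa using hsu.2.2.1) hA).ctx (aPow P ++ d) z
          (x := aPow P ++ (d ++ (.r, ε) :: (κ ++ (.r, !ε) :: z))) (y := aPow P ++ (d ++ κ ++ z))
          (by simp) (by simp) le_rfl
        simp only [List.length_append, List.length_cons] at hN hc
        refine sComm_of_conv e hc (by simp; omega) (by simp; omega) ?_
        refine ih _ (by simp [Prod.Lex.toLex_lt_toLex]) q P (d ++ κ ++ z) h
          (by simp; omega) hP ?_ hah hbh hsh ?_ rfl
        · simpa using ⟨hsu.1, hsu.2.2.1, hsu.2.2.2.2⟩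
        · rw [hval, hc.val_eq isModel_assignR]

end Fillable

theorem exists_word_of_mem_centS {y : GroupR} (hy : y ∈ centS) :
    ∃ h : Word QGen, Avoids .a h ∧ Avoids .b h ∧ Avoids .s h ∧ val assignR h = y := by
  induction hy using Subgroup.closure_induction with
  | mem y hy =>
    obtain rfl | rfl := hy
    · exact ⟨[(.r, true)], by simp⟩
    · exact ⟨[(.t, true)], by simp⟩
  | one => exact ⟨[], by simp⟩
  | mul x y _ _ hx hy =>
    obtain ⟨u, hu⟩ := hx
    obtain ⟨v, hv⟩ := hy
    exact ⟨u ++ v, by simp [*]⟩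
  | inv x _ hx =>
    obtain ⟨u, hu⟩ := hx
    exact ⟨Word.inv u, by simp [*]⟩

theorem countLtr_append {A : Type*} [DecidableEq A] (x : A) (u v : Word A) :
    countLtr x (u ++ v) = countLtr x u + countLtr x v := by
  simp [countLtr]

theorem countLtr_eq_zero {A : Type*} [DecidableEq A] {x : A} {u : Word A} :
    countLtr x u = 0 ↔ Avoids x u := by
  simp [countLtr, Avoids]

theorem countLtr_cons_self {A : Type*} [DecidableEq A] (x : A) (e : Bool) (u : Word A) :
    countLtr x ((x, e) :: u) = countLtr x u + 1 := by
  simp [countLtr]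

theorem fillable_of_countLtr_s {w : Word QGen} (hw : NullHomotopic QRels w)
    (h2 : countLtr .s w = 2) : Fillable (3000 * w.length) w := by
  have hone := val_eq_one_of_nullHomotopic assignS (fun z hz => isModel_assignS.val_relator hz) hw
  obtain ⟨p, e, κ, q, rfl, hκ, hA⟩ := hasPinch_of_val_eq_one (g := assignR) (A := centS) (x := .s)
    hone (by rw [← countLtr_eq_zero]; omega)
  rw [List.append_assoc, List.cons_append] at *
  simp only [countLtr_append, countLtr_cons_self] at h2
  have hp : Avoids .s p := countLtr_eq_zero.1 (by omega)
  have hq : Avoids .s q := countLtr_eq_zero.1 (by omega)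
  have hpκq : val assignR (p ++ (κ ++ q)) = 1 := by
    have h : val assignS ((.s, e) :: κ ++ [(.s, !e)]) = val assignS κ :=
      val_pinch (g := assignR) e hκ hA
    refine HNNExtension.of_injective (MulEquiv.refl centS) ?_
    refine (val_stableAssign_of_avoids assignR centS .s ?_).symm.trans (Eq.trans ?_
      (hone.trans (map_one _).symm))
    · simpa using ⟨hp, hκ, hq⟩
    · change val assignS (p ++ (κ ++ q)) = _
      rw [show p ++ (.s, e) :: (κ ++ (.s, !e) :: q) = p ++ (((.s, e) :: κ ++ [(.s, !e)]) ++ q) by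
        simp, val_append, val_append _ p, val_append _ κ, val_append _ _ q, h]
  obtain ⟨h, hah, hbh, hsh, hval⟩ := exists_word_of_mem_centS hA
  refine Fillable.rotate ?_
  have hc : Conv (158 * (p.length + κ.length + q.length) + 100 + κ.length) (q ++ p)
      (Word.inv κ) := by
    refine Conv.of_mul_inv (conv_nil_of_val_assignR (by simpa using ⟨hq, hp, hκ⟩) ?_)
      (by simp; omega) (by simp; omega)
    rw [val_append, mul_eq_one_iff_eq_inv] at hpκq
    rw [Word.inv_inv, val_append, val_append, hpκq, val_append]
    group
  generalize hL : 3000 * (p ++ (.s, e) :: (κ ++ (.s, !e) :: q)).length = L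
  simp only [List.length_append, List.length_cons] at hL
  refine Fillable.of_conv (v := sComm e κ) (hc.ctx ((.s, e) :: κ ++ [(.s, !e)]) [] (by simp)
    (by simp [sComm]) (by simp; omega)) ?_
  simpa using Fillable.sComm_aPow_append (N := κ.length) (L := L) (by omega) e 0 0 κ h (by simp)
    (by simp) hκ hah hbh hsh (by simpa)

end TwoLetters

theorem FFFL_linear_of_two_s :
    ∃ C : ℕ, 0 < C ∧ ∀ w : Word QGen, NullHomotopic QRels w →
      countLtr QGen.s w = 2 → FFFLle QRels w (C * w.length) :=
  ⟨3000, by simp, fun _ hw h2 => (fillable_of_countLtr_s hw h2).fffle⟩
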